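/- On ℝ² with coordinates (u, t), set T(u,t) = t³ + ut², T₁(u,t) = (3/4)t⁴ + (2/3)ut³, and T₃(u,t) = (1/2)t⁶ + (2/5)ut⁵. Let h : ℝ² → ℝ be a C^∞ function-germ at 0 such that there exist C^∞ function-germs k₁, k₂ at 0 ∈ ℝ² with h(u,t) = t³·k₁(u,t) and ∂h/∂t(u,t) = t³·(3t² + 2ut)·k₂(u,t) near 0 (i.e. h lies in ℛ_g^{(3)} for g(u,t) = (u, T(u,t))). Then there exist C^∞ function-germs a, b, c at 0 ∈ ℝ² such that, near 0, h(u,t) = a(u, T(u,t))·T₃(u,t) + b(u, T(u,t))·T(u,t)·T₁(u,t) + c(u, T(u,t))·T₁(u,t)². -/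

import Mathlib

open Filter Topology

/-- `T(u,t) = t³ + ut²`. -/
noncomputable def Tg (p : ℝ × ℝ) : ℝ := p.2 ^ 3 + p.1 * p.2 ^ 2

/-- `T₁(u,t) = (3/4)t⁴ + (2/3)ut³`. -/
noncomputable def T1 (p : ℝ × ℝ) : ℝ := (3/4) * p.2 ^ 4 + (2/3) * p.1 * p.2 ^ 3

/-- `T₃(u,t) = (1/2)t⁶ + (2/5)ut⁵`. -/
noncomputable def T3 (p : ℝ × ℝ) : ℝ := (1/2) * p.2 ^ 6 + (2/5) * p.1 * p.2 ^ 5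

set_option linter.unusedSectionVars false

/-- germs at the origin -/
def Sm {E F : Type} [NormedAddCommGroup E] [NormedSpace ℝ E] [NormedAddCommGroup F]
    [NormedSpace ℝ F] (f : E → F) : Prop := ContDiffAt ℝ (⊤ : ℕ∞) f 0

section basics
variable {E F G : Type} [NormedAddCommGroup E] [NormedSpace ℝ E] [NormedAddCommGroup F]
    [NormedSpace ℝ F] [NormedAddCommGroup G] [NormedSpace ℝ G]

lemma Sm_iff {f : E → F} : Sm f ↔ ∀ n : ℕ, ContDiffAt ℝ n f 0 := contDiffAt_infty

lemma Sm.congr {f g : E → F} (hf : Sm f) (h : g =ᶠ[𝓝 0] f) : Sm g :=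
  ContDiffAt.congr_of_eventuallyEq hf h

lemma Sm.comp {g : F → G} {f : E → F} (hg : Sm g) (hf : Sm f) (h0 : f 0 = 0) :
    Sm (fun x => g (f x)) := by
  unfold Sm at *
  rw [← h0] at hg
  exact ContDiffAt.comp 0 hg hf

lemma Sm.eventually {f : E → F} (hf : Sm f) (n : ℕ) : ∀ᶠ x in 𝓝 (0 : E), ContDiffAt ℝ n f x :=
  (Sm_iff.1 hf n).eventually (by simp)

lemma Sm.ev_diff {f : E → F} (hf : Sm f) : ∀ᶠ x in 𝓝 (0 : E), DifferentiableAt ℝ f x :=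
  (hf.eventually 1).mono fun _ hx => hx.differentiableAt (by simp)

lemma Sm.ev_cont {f : E → F} (hf : Sm f) : ∀ᶠ x in 𝓝 (0 : E), ContinuousAt f x :=
  (hf.eventually 1).mono fun _ hx => hx.continuousAt

lemma Sm.fderiv {f : E → F} (hf : Sm f) : Sm (fderiv ℝ f) :=
  ContDiffAt.fderiv_right (m := ((⊤ : ℕ∞) : WithTop ℕ∞)) hf (by simp)

lemma glob [FiniteDimensional ℝ E] {f : E → F} {n : ℕ} (hf : ContDiffAt ℝ n f 0) :
    ∃ g : E → F, ContDiff ℝ n g ∧ HasCompactSupport g ∧ g =ᶠ[𝓝 0] f := by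
  have h1 := hf.eventually (by simp)
  obtain ⟨r, hr, hb⟩ := Metric.eventually_nhds_iff_ball.1 h1
  let χ : ContDiffBump (0 : E) := ⟨r / 3, r / 2, by positivity, by linarith⟩
  refine ⟨fun x => χ x • f x, ?_, ?_, ?_⟩
  · rw [contDiff_iff_contDiffAt]
    intro x
    by_cases hx : x ∈ Metric.ball (0 : E) r
    · exact χ.contDiff.contDiffAt.smul (hb x hx)
    · have hx' : x ∉ tsupport χ := by
        rw [χ.tsupport_eq]
        intro h
        apply hx
        exact Metric.closedBall_subset_ball (by simp [χ]; linarith) h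
      have : (fun x => χ x • f x) =ᶠ[𝓝 x] fun _ => 0 := by
        filter_upwards [notMem_tsupport_iff_eventuallyEq.1 hx'] with y hy
        simp [hy]
      exact contDiffAt_const.congr_of_eventuallyEq this
  · exact χ.hasCompactSupport.smul_right
  · filter_upwards [χ.eventuallyEq_one] with y hy
    simp [hy]

end basics

section integral
variable {P : Type} [NormedAddCommGroup P] [NormedSpace ℝ P] [FiniteDimensional ℝ P]

lemma contDiff_param_integral (n : ℕ) : ∀ {F : Type} [NormedAddCommGroup F] [NormedSpace ℝ F]
    [CompleteSpace F] (f : P × ℝ → F), ContDiff ℝ n f →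
    ContDiff ℝ n (fun p => ∫ θ in (0 : ℝ)..1, f (p, θ)) := by
  induction n with
  | zero =>
    intro F _ _ _ f hf
    have hc : Continuous f := hf.continuous
    simp only [Nat.cast_zero, contDiff_zero]
    exact intervalIntegral.continuous_parametric_intervalIntegral_of_continuous'
      (f := fun p θ => f (p, θ)) hc 0 1
  | succ n ih =>
    intro F _ _ _ f hf
    have hd : Differentiable ℝ f := hf.differentiable (by simp)
    let D : P × ℝ → (P →L[ℝ] F) := fun z => (fderiv ℝ f z).comp (ContinuousLinearMap.inl ℝ P ℝ)
    have hD : ContDiff ℝ n D :=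
      (hf.fderiv_right (m := n) (by simp)).clm_comp contDiff_const
    have hDc : Continuous D := hD.continuous
    have key : ∀ p, HasFDerivAt (fun p => ∫ θ in (0 : ℝ)..1, f (p, θ))
        (∫ θ in (0 : ℝ)..1, D (p, θ)) p := by
      intro p
      have : ProperSpace P := FiniteDimensional.proper ℝ P
      have hK : IsCompact (Metric.closedBall p 1 ×ˢ Set.Icc (0 : ℝ) 1) :=
        (isCompact_closedBall p 1).prod isCompact_Icc
      obtain ⟨C, hC⟩ := hK.exists_bound_of_continuousOn hDc.continuousOn
      refine intervalIntegral.hasFDerivAt_integral_of_dominated_of_fderiv_le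
        (F' := fun p θ => D (p, θ)) (bound := fun _ => C)
        (Metric.closedBall_mem_nhds p one_pos) ?_ ?_ ?_ ?_ ?_ ?_
      · refine Eventually.of_forall fun x => ?_
        exact (hf.continuous.comp (by fun_prop : Continuous fun θ : ℝ => (x, θ))).aestronglyMeasurable
      · exact (hf.continuous.comp (by fun_prop : Continuous fun θ : ℝ => (p, θ))).intervalIntegrable _ _
      · exact (hDc.comp (by fun_prop : Continuous fun θ : ℝ => (p, θ))).aestronglyMeasurable
      · refine Eventually.of_forall fun θ hθ x hx => hC _ ⟨hx, ?_⟩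
        rw [Set.uIoc_of_le zero_le_one] at hθ
        exact ⟨hθ.1.le, hθ.2⟩
      · simp
      · refine Eventually.of_forall fun θ _ x _ => ?_
        exact (hd (x, θ)).hasFDerivAt.comp x (hasFDerivAt_prodMk_left x θ)
    rw [show ((n + 1 : ℕ) : WithTop ℕ∞) = (n : WithTop ℕ∞) + 1 by simp, contDiff_succ_iff_hasFDerivAt]
    exact ⟨_, ih D hD, key⟩

/-- Hadamard quotient. -/
noncomputable def hq {X : Type} (n : ℕ) (q : X × ℝ → ℝ) (p : X × ℝ) : ℝ :=
  ∫ θ in (0 : ℝ)..1, θ ^ n * q (p.1, θ * p.2)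

lemma ball_scale {X : Type} [NormedAddCommGroup X] {r : ℝ} {p : X × ℝ}
    (hp : p ∈ Metric.ball (0 : X × ℝ) r) {θ : ℝ} (hθ : θ ∈ Set.Icc (0 : ℝ) 1) :
    (p.1, θ * p.2) ∈ Metric.ball (0 : X × ℝ) r := by
  rw [mem_ball_zero_iff, Prod.norm_def] at *
  refine lt_of_le_of_lt (max_le_max le_rfl ?_) hp
  simp only [norm_mul, Real.norm_eq_abs, abs_of_nonneg hθ.1]
  exact mul_le_of_le_one_left (abs_nonneg _) hθ.2

lemma Sm_hq {q : P × ℝ → ℝ} (hqq : Sm q) (n : ℕ) : Sm (hq n q) := by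
  rw [Sm_iff]
  intro m
  obtain ⟨g, hg, -, hgq⟩ := glob (Sm_iff.1 hqq m)
  have h0 : ContDiff ℝ m (fun z : (P × ℝ) × ℝ => z.2 ^ n * g (z.1.1, z.2 * z.1.2)) := by
    fun_prop
  have h1 : ContDiff ℝ m (fun p : P × ℝ => ∫ θ in (0 : ℝ)..1,
      (fun z : (P × ℝ) × ℝ => z.2 ^ n * g (z.1.1, z.2 * z.1.2)) (p, θ)) :=
    contDiff_param_integral m _ h0
  refine h1.contDiffAt.congr_of_eventuallyEq ?_
  obtain ⟨r, hr, hb⟩ := Metric.eventually_nhds_iff_ball.1 hgq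
  filter_upwards [Metric.ball_mem_nhds _ hr] with p hp
  unfold hq
  refine intervalIntegral.integral_congr fun θ hθ => ?_
  rw [Set.uIcc_of_le zero_le_one] at hθ
  simp only [hb _ (ball_scale hp hθ)]

lemma hadamard_n {f q : P × ℝ → ℝ} (hqq : Sm q) (n : ℕ)
    (hd : ∀ᶠ p in 𝓝 (0 : P × ℝ), HasDerivAt (fun t => f (p.1, t)) (p.2 ^ n * q p) p.2) :
    ∀ᶠ p in 𝓝 (0 : P × ℝ), f p = f (p.1, 0) + p.2 ^ (n + 1) * hq n q p := by
  obtain ⟨r, hr, hb⟩ := Metric.eventually_nhds_iff_ball.1 (hd.and hqq.ev_cont)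
  filter_upwards [Metric.ball_mem_nhds _ hr] with p hp
  have h1 : ∀ θ ∈ Set.uIcc (0 : ℝ) 1, HasDerivAt (fun θ => f (p.1, θ * p.2))
      (p.2 ^ (n + 1) * (θ ^ n * q (p.1, θ * p.2))) θ := by
    intro θ hθ
    rw [Set.uIcc_of_le zero_le_one] at hθ
    have h2 := (hb _ (ball_scale hp hθ)).1
    have h3 : HasDerivAt (fun θ : ℝ => θ * p.2) (p.2) θ := by
      simpa using (hasDerivAt_id θ).mul_const p.2
    have := HasDerivAt.comp θ (h₂ := fun t => f (p.1, t)) (h := fun θ => θ * p.2) h2 h3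
    refine this.congr_deriv ?_
    simp only
    ring
  have h2 : ContinuousOn (fun θ => p.2 ^ (n + 1) * (θ ^ n * q (p.1, θ * p.2))) (Set.uIcc (0 : ℝ) 1) := by
    intro θ hθ
    rw [Set.uIcc_of_le zero_le_one] at hθ
    have h3 := (hb _ (ball_scale hp hθ)).2
    have h4 : ContinuousAt (fun θ : ℝ => q (p.1, θ * p.2)) θ :=
      ContinuousAt.comp (f := fun θ : ℝ => (p.1, θ * p.2)) h3 (by fun_prop)
    exact ContinuousAt.continuousWithinAt (by fun_prop)
  have h3 := intervalIntegral.integral_eq_sub_of_hasDerivAt h1 h2.intervalIntegrable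
  rw [intervalIntegral.integral_const_mul] at h3
  unfold hq
  rw [h3]
  simp

/-- partial derivative in the last variable -/
noncomputable def dt {X : Type} [NormedAddCommGroup X] [NormedSpace ℝ X] (f : X × ℝ → ℝ)
    (p : X × ℝ) : ℝ := fderiv ℝ f p (0, 1)

lemma Sm_dt {f : P × ℝ → ℝ} (hf : Sm f) : Sm (dt f) :=
  ContDiffAt.clm_apply hf.fderiv contDiffAt_const

lemma hasDerivAt_dt {f : P × ℝ → ℝ} {p : P × ℝ} (h : DifferentiableAt ℝ f p) :
    HasDerivAt (fun t => f (p.1, t)) (dt f p) p.2 := by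
  have h1 : HasDerivAt (fun t : ℝ => (p.1, t)) ((0 : P), (1 : ℝ)) p.2 :=
    (hasDerivAt_const _ _).prodMk (hasDerivAt_id _)
  exact HasFDerivAt.comp_hasDerivAt p.2 (l := f) (f := fun t : ℝ => (p.1, t)) h.hasFDerivAt h1

lemma hadamard {f : P × ℝ → ℝ} (hf : Sm f) :
    ∃ g : P × ℝ → ℝ, Sm g ∧ ∀ᶠ p in 𝓝 (0 : P × ℝ), f p = f (p.1, 0) + p.2 * g p := by
  refine ⟨hq 0 (dt f), Sm_hq (Sm_dt hf) 0, ?_⟩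
  have := hadamard_n (f := f) (Sm_dt hf) 0 (by
    filter_upwards [hf.ev_diff] with p hp
    simpa using hasDerivAt_dt hp)
  simpa using this

end integral

set_option linter.unusedSectionVars false

section borel
variable {X : Type} [NormedAddCommGroup X] [NormedSpace ℝ X] [FiniteDimensional ℝ X]

lemma borel_bounds (g : ℕ → X → ℝ) (hg : ∀ k : ℕ, ContDiff ℝ k (g k))
    (hc : ∀ k, HasCompactSupport (g k)) (χ : ContDiffBump (0 : ℝ)) (k : ℕ) :
    ∃ M : ℝ, 0 ≤ M ∧ ∀ j ≤ k, ∀ n ≤ k, ∀ p : X × ℝ,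
      ‖iteratedFDeriv ℝ n (fun p : X × ℝ => g k p.1 * (p.2 ^ j * χ p.2)) p‖ ≤ M := by
  have h1 : ∀ j n : ℕ, ∃ C : ℝ, n ≤ k → ∀ p : X × ℝ,
      ‖iteratedFDeriv ℝ n (fun p : X × ℝ => g k p.1 * (p.2 ^ j * χ p.2)) p‖ ≤ C := by
    intro j n
    by_cases hn : n ≤ k
    · have hs : ContDiff ℝ k (fun p : X × ℝ => g k p.1 * (p.2 ^ j * χ p.2)) := by
        have h1 : ContDiff ℝ k (g k) := hg k
        have h2 : ContDiff ℝ k χ := χ.contDiff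
        fun_prop
      have hcs : HasCompactSupport (fun p : X × ℝ => g k p.1 * (p.2 ^ j * χ p.2)) := by
        refine HasCompactSupport.intro ((hc k).isCompact.prod χ.hasCompactSupport.isCompact) ?_
        rintro ⟨x, w⟩ hp
        by_cases hx : x ∈ tsupport (g k)
        · have hw : w ∉ tsupport χ := fun hw => hp ⟨hx, hw⟩
          simp [image_eq_zero_of_notMem_tsupport hw]
        · simp [image_eq_zero_of_notMem_tsupport hx]
      obtain ⟨C, hC⟩ := (hs.continuous_iteratedFDeriv (m := n) (by exact_mod_cast hn)).bounded_above_of_compact_support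
        (hcs.iteratedFDeriv n)
      exact ⟨C, fun _ => hC⟩
    · exact ⟨0, fun h => absurd h hn⟩
  choose C hC using h1
  refine ⟨∑ j ∈ Finset.range (k + 1), ∑ n ∈ Finset.range (k + 1), |C j n|, by positivity, ?_⟩
  intro j hj n hn p
  calc _ ≤ C j n := hC j n hn p
    _ ≤ |C j n| := le_abs_self _
    _ ≤ ∑ n ∈ Finset.range (k + 1), |C j n| :=
      Finset.single_le_sum (f := fun n => |C j n|) (fun _ _ => abs_nonneg _) (by simp; omega)
    _ ≤ _ := Finset.single_le_sum (f := fun j => ∑ n ∈ Finset.range (k + 1), |C j n|)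
      (fun _ _ => Finset.sum_nonneg fun _ _ => abs_nonneg _) (by simp; omega)

/-- the terms in the Borel sums -/
noncomputable def bterm (g : ℕ → X → ℝ) (χ : ℝ → ℝ) (ε : ℕ → ℝ) (N j : ℕ) (p : X × ℝ) : ℝ :=
  g (j + N) p.1 * (p.2 ^ j * χ (p.2 / ε (j + N)))

lemma bterm_bound (g : ℕ → X → ℝ) (hg : ∀ k : ℕ, ContDiff ℝ k (g k))
    (χ : ContDiffBump (0 : ℝ)) (ε : ℕ → ℝ) (M : ℕ → ℝ)
    (hM : ∀ k, ∀ j ≤ k, ∀ n ≤ k, ∀ p : X × ℝ,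
      ‖iteratedFDeriv ℝ n (fun p : X × ℝ => g k p.1 * (p.2 ^ j * χ p.2)) p‖ ≤ M k)
    (h0 : ∀ k, 0 < ε k) (h1 : ∀ k, ε k ≤ 1) (h2 : ∀ k, ε k * M k ≤ (1 / 2) ^ k)
    (hM0 : ∀ k, 0 ≤ M k)
    (N j n : ℕ) (hn : n < j) (p : X × ℝ) :
    ‖iteratedFDeriv ℝ n (bterm g χ ε N j) p‖ ≤ (1 / 2 : ℝ) ^ j := by
  set k := j + N with hk
  set H : X × ℝ → ℝ := fun p : X × ℝ => g k p.1 * (p.2 ^ j * χ p.2) with hH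
  have hHs : ContDiff ℝ k H := by
    have h1 : ContDiff ℝ k (g k) := hg k
    have h2 : ContDiff ℝ k χ := χ.contDiff
    fun_prop
  let L : (X × ℝ) →L[ℝ] (X × ℝ) :=
    (ContinuousLinearMap.fst ℝ X ℝ).prod ((ε k)⁻¹ • ContinuousLinearMap.snd ℝ X ℝ)
  have hε := h0 k
  have hLn : ‖L‖ ≤ (ε k)⁻¹ := by
    refine ContinuousLinearMap.opNorm_le_bound _ (by positivity) fun z => ?_
    have e1 : (1 : ℝ) ≤ (ε k)⁻¹ := (one_le_inv₀ hε).2 (h1 k)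
    rw [Prod.norm_def]
    refine max_le ?_ ?_
    · simp only [L, ContinuousLinearMap.prod_apply, ContinuousLinearMap.coe_fst']
      calc ‖z.1‖ ≤ ‖z‖ := norm_fst_le z
        _ ≤ (ε k)⁻¹ * ‖z‖ := le_mul_of_one_le_left (norm_nonneg _) e1
    · simp only [L, ContinuousLinearMap.prod_apply, smul_apply,
        ContinuousLinearMap.coe_snd', norm_smul, norm_inv, Real.norm_eq_abs, abs_of_pos hε]
      gcongr
      exact norm_snd_le z
  have hfe : bterm g χ ε N j = fun p => (ε k) ^ j • (H ∘ L) p := by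
    funext z
    simp only [bterm, H, L, Function.comp, ContinuousLinearMap.prod_apply,
      ContinuousLinearMap.coe_fst', smul_apply, ContinuousLinearMap.coe_snd',
      smul_eq_mul, ← hk]
    rw [div_eq_inv_mul, mul_pow]
    have : ε k ^ j * (ε k)⁻¹ ^ j = 1 := by rw [← mul_pow, mul_inv_cancel₀ hε.ne', one_pow]
    linear_combination (- g k z.1 * z.2 ^ j * χ ((ε k)⁻¹ * z.2)) * this
  rw [hfe]
  have hnk : (n : WithTop ℕ∞) ≤ k := by exact_mod_cast (by omega : n ≤ k)
  rw [iteratedFDeriv_const_smul_apply' ((hHs.comp L.contDiff).of_le hnk).contDiffAt,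
    L.iteratedFDeriv_comp_right hHs p hnk, norm_smul]
  have e3 : ‖(iteratedFDeriv ℝ n H (L p)).compContinuousLinearMap fun _ => L‖ ≤ M k * ((ε k)⁻¹) ^ n := by
    refine (ContinuousMultilinearMap.norm_compContinuousLinearMap_le _ _).trans ?_
    simp only [Finset.prod_const, Finset.card_univ, Fintype.card_fin]
    have := hM k j (by omega) n (by omega) (L p)
    have := hM0 k
    gcongr
  have e4 : ‖ε k ^ j‖ = ε k ^ (j - n - 1) * ε k * ε k ^ n := by
    rw [norm_pow, Real.norm_eq_abs, abs_of_pos hε, ← pow_succ, ← pow_add]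
    congr 1; omega
  calc _ ≤ ‖ε k ^ j‖ * (M k * ((ε k)⁻¹) ^ n) := by gcongr
    _ = ε k ^ (j - n - 1) * (ε k * M k) := by
      rw [e4, inv_pow]; field_simp
    _ ≤ 1 * (1 / 2) ^ k := by
      have := hM0 k
      gcongr
      · exact pow_le_one₀ hε.le (h1 k)
      · exact h2 k
    _ ≤ (1 / 2) ^ j := by
      rw [one_mul]
      exact pow_le_pow_of_le_one (by norm_num) (by norm_num) (by omega)

lemma borel_sum (e : ℕ → X → ℝ) (he : ∀ k, Sm (e k)) :
    ∃ R : ℕ → X × ℝ → ℝ, (∀ N, Sm (R N)) ∧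
      ∀ N, ∀ᶠ p in 𝓝 (0 : X × ℝ), R N p = e N p.1 + p.2 * R (N + 1) p := by
  have h1 : ∀ k : ℕ, ∃ g : X → ℝ, ContDiff ℝ k g ∧ HasCompactSupport g ∧ g =ᶠ[𝓝 0] e k :=
    fun k => glob (Sm_iff.1 (he k) k)
  choose g hg hgc hge using h1
  let χ : ContDiffBump (0 : ℝ) := ⟨1, 2, by norm_num, by norm_num⟩
  choose M hM0 hM using borel_bounds g hg hgc χ
  let ε : ℕ → ℝ := fun k => (1 / 2) ^ k / (M k + 1)
  have hε0 : ∀ k, 0 < ε k := fun k => by have := hM0 k; positivity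
  have hε1 : ∀ k, ε k ≤ 1 := fun k => by
    have := hM0 k
    refine (div_le_one (by positivity)).2 ?_
    have : (1 / 2 : ℝ) ^ k ≤ 1 := pow_le_one₀ (by norm_num) (by norm_num)
    linarith
  have hε2 : ∀ k, ε k * M k ≤ (1 / 2) ^ k := fun k => by
    have := hM0 k
    simp only [ε]
    rw [div_mul_eq_mul_div, div_le_iff₀ (by positivity)]
    gcongr
    linarith
  have hb := bterm_bound g hg χ ε M hM hε0 hε1 hε2 hM0
  have hgeo : Summable fun j : ℕ => (1 / 2 : ℝ) ^ j := summable_geometric_two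
  have hsum : ∀ N p, Summable fun j => bterm g χ ε N j p := by
    intro N p
    rw [← summable_nat_add_iff 1]
    refine Summable.of_norm_bounded ((summable_nat_add_iff 1).2 hgeo) fun j => ?_
    have := hb N (j + 1) 0 (by omega) p
    rwa [norm_iteratedFDeriv_zero] at this
  have hgSm : ∀ k, Sm (g k) := fun k => (he k).congr (hge k)
  have htSm : ∀ N j, Sm (bterm g χ ε N j) := by
    intro N j
    have a1 : Sm (fun p : X × ℝ => g (j + N) p.1) := (hgSm _).comp contDiffAt_fst rfl
    have a2 : ContDiff ℝ (⊤ : ℕ∞) χ := χ.contDiff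
    have a3 : ContDiff ℝ (⊤ : ℕ∞) (fun p : X × ℝ => p.2 ^ j * χ (p.2 / ε (j + N))) := by
      fun_prop
    exact ContDiffAt.mul a1 a3.contDiffAt
  refine ⟨fun N p => ∑' j, bterm g χ ε N j p, ?_, ?_⟩
  · intro N
    rw [Sm_iff]
    intro n
    have e1 : (fun p => ∑' j, bterm g χ ε N j p) = fun p =>
        (∑ j ∈ Finset.range (n + 1), bterm g χ ε N j p) + ∑' j, bterm g χ ε N (j + (n + 1)) p := by
      funext p
      exact ((hsum N p).sum_add_tsum_nat_add (n + 1)).symm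
    beta_reduce
    rw [e1]
    refine ContDiffAt.add (ContDiffAt.sum fun j _ => Sm_iff.1 (htSm N j) n) ?_
    refine (contDiff_tsum (N := n) (v := fun _ j => (1 / 2 : ℝ) ^ (j + (n + 1))) ?_ ?_ ?_).contDiffAt
    · intro j
      have a1 : ContDiff ℝ n (g (j + (n + 1) + N)) := (hg _).of_le (by exact_mod_cast (by omega))
      have a2 : ContDiff ℝ n χ := χ.contDiff
      unfold bterm
      simp only [WithTop.coe_natCast]
      fun_prop
    · intro k _
      exact (summable_nat_add_iff (n + 1)).2 hgeo
    · intro k j p hk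
      refine hb N _ k ?_ p
      have : k ≤ n := by exact_mod_cast hk
      omega
  · intro N
    have b1 : ∀ᶠ p in 𝓝 (0 : X × ℝ), g N p.1 = e N p.1 :=
      (continuous_fst.tendsto (0 : X × ℝ)).eventually (hge N)
    have b2 : ∀ᶠ p in 𝓝 (0 : X × ℝ), χ (p.2 / ε N) = 1 := by
      have : Tendsto (fun p : X × ℝ => p.2 / ε N) (𝓝 0) (𝓝 0) := by
        have h : Continuous (fun p : X × ℝ => p.2 / ε N) := by fun_prop
        simpa using h.tendsto 0
      exact this.eventually χ.eventuallyEq_one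
    filter_upwards [b1, b2] with p h1 h2
    rw [(hsum N p).tsum_eq_zero_add, ← tsum_mul_left]
    congr 1
    · simp [bterm, h1, h2]
    · congr 1
      funext j
      unfold bterm
      rw [show j + 1 + N = j + (N + 1) by omega]
      ring

end borel

set_option linter.unusedSectionVars false

section flat
variable {X : Type} [NormedAddCommGroup X] [NormedSpace ℝ X] [FiniteDimensional ℝ X]

def Flat {F : Type} [NormedAddCommGroup F] [NormedSpace ℝ F] (Φ : X × ℝ → F) : Prop :=
  ∀ N : ℕ, ∃ K : X × ℝ → F, Sm K ∧ ∀ᶠ p in 𝓝 (0 : X × ℝ), Φ p = p.2 ^ N • K p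

noncomputable def E0 {F : Type} [NormedAddCommGroup F] [NormedSpace ℝ F] (Φ : X × ℝ → F)
    (p : X × ℝ) : F := if 0 < p.2 then Φ (p.1, √p.2) else 0

noncomputable def Msig (σ : ℝ) : (X × ℝ) →L[ℝ] (X × ℝ) :=
  (ContinuousLinearMap.fst ℝ X ℝ).prod ((1 / (2 * σ)) • ContinuousLinearMap.snd ℝ X ℝ)

noncomputable def Theta {F : Type} [NormedAddCommGroup F] [NormedSpace ℝ F] (Φ : X × ℝ → F)
    (p : X × ℝ) : (X × ℝ) →L[ℝ] F := (fderiv ℝ Φ p).comp (Msig p.2)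

lemma Flat.theta {F : Type} [NormedAddCommGroup F] [NormedSpace ℝ F] {Φ : X × ℝ → F}
    (h : Flat Φ) : Flat (Theta Φ) := by
  intro N
  obtain ⟨K, hK, hΦ⟩ := h (N + 3)
  let K' : X × ℝ → ((X × ℝ) →L[ℝ] F) := fun p =>
    p.2 • fderiv ℝ K p + ((N + 3 : ℕ) : ℝ) • (ContinuousLinearMap.snd ℝ X ℝ).smulRight (K p)
  let M' : X × ℝ → ((X × ℝ) →L[ℝ] (X × ℝ)) := fun p =>
    (p.2 • ContinuousLinearMap.fst ℝ X ℝ).prod ((1 / 2 : ℝ) • ContinuousLinearMap.snd ℝ X ℝ)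
  have hs2 : ContDiffAt ℝ (⊤ : ℕ∞) (fun p : X × ℝ => p.2) 0 := contDiffAt_snd
  have hK' : Sm K' := by
    have h1 : ContDiffAt ℝ (⊤ : ℕ∞) (fderiv ℝ K) 0 := hK.fderiv
    have h2 : ContDiffAt ℝ (⊤ : ℕ∞) K 0 := hK
    have h3 : ContDiffAt ℝ (⊤ : ℕ∞)
        (fun p => (ContinuousLinearMap.snd ℝ X ℝ).smulRight (K p)) 0 :=
      ContDiffAt.smulRight contDiffAt_const h2
    exact ContDiffAt.add (hs2.smul h1) (ContDiffAt.const_smul _ h3)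
  have hM' : Sm M' := by
    have : ContDiffAt ℝ (⊤ : ℕ∞) (fun p : X × ℝ =>
        p.2 • (ContinuousLinearMap.inl ℝ X ℝ).comp (ContinuousLinearMap.fst ℝ X ℝ) +
        (1 / 2 : ℝ) • (ContinuousLinearMap.inr ℝ X ℝ).comp (ContinuousLinearMap.snd ℝ X ℝ)) 0 :=
      ContDiffAt.add (hs2.smul contDiffAt_const) contDiffAt_const
    refine Sm.congr this (Eventually.of_forall fun p => ?_)
    ext z <;> simp [M']
  refine ⟨fun p => p.2 • (K' p).comp (M' p), hs2.smul (ContDiffAt.clm_comp hK' hM'), ?_⟩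
  filter_upwards [hΦ.eventually_nhds, hK.ev_diff] with p hp hd
  have h1 : HasFDerivAt (fun p : X × ℝ => p.2 ^ (N + 3) • K p) (p.2 ^ (N + 2) • K' p) p := by
    have a1 : HasFDerivAt (fun p : X × ℝ => p.2) (ContinuousLinearMap.snd ℝ X ℝ) p := hasFDerivAt_snd
    have a2 := (a1.pow (N + 3)).smul hd.hasFDerivAt
    refine a2.congr_fderiv ?_
    ext z <;> simp [K', smul_smul] <;> ring_nf
  have h2 : fderiv ℝ Φ p = p.2 ^ (N + 2) • K' p := by
    rw [← h1.fderiv]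
    exact Filter.EventuallyEq.fderiv_eq hp
  unfold Theta
  rw [h2]
  by_cases h0 : p.2 = 0
  · simp [h0]
  · have : Msig p.2 = (p.2)⁻¹ • M' p := by
      ext z
      · simp [Msig, M', smul_smul, h0]
      · simp [Msig, M', smul_smul, h0]
      · simp [Msig, M', smul_smul, h0]
      · simp [Msig, M', smul_smul, h0]
    rw [this, ContinuousLinearMap.comp_smul, ContinuousLinearMap.smul_comp, smul_smul, smul_smul]
    congr 1
    field_simp
    ring

lemma tendsto_sqrt_pair : Tendsto (fun p : X × ℝ => (p.1, √p.2)) (𝓝 0) (𝓝 0) := by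
  have h : Continuous (fun p : X × ℝ => (p.1, √p.2)) := by fun_prop
  simpa [← Prod.zero_eq_mk] using h.tendsto 0

lemma E0_hasFDerivAt {F : Type} [NormedAddCommGroup F] [NormedSpace ℝ F] {Φ : X × ℝ → F}
    (h : Flat Φ) : ∀ᶠ p in 𝓝 (0 : X × ℝ), HasFDerivAt (E0 Φ) (E0 (Theta Φ) p) p := by
  obtain ⟨K, hK, hΦ⟩ := h 4
  obtain ⟨K1, hK1, hΦ1⟩ := h 0
  have hΦd : Sm Φ := hK1.congr (hΦ1.mono fun p hp => by simpa using hp)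
  obtain ⟨C, hC⟩ : ∃ C : ℝ, ∀ᶠ p in 𝓝 (0 : X × ℝ), ‖K p‖ ≤ C := by
    have : ContinuousAt K 0 := hK.ev_cont.self_of_nhds
    refine ⟨‖K 0‖ + 1, ?_⟩
    exact (this.norm.eventually (gt_mem_nhds (lt_add_one ‖K 0‖))).mono fun p hp => le_of_lt hp
  have hb : ∀ᶠ p in 𝓝 (0 : X × ℝ), ‖E0 Φ p‖ ≤ C * p.2 ^ 2 := by
    filter_upwards [tendsto_sqrt_pair.eventually hΦ, tendsto_sqrt_pair.eventually hC] with p h1 h2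
    have hC0 : 0 ≤ C := (norm_nonneg _).trans h2
    unfold E0
    split_ifs with hp
    · rw [h1, norm_smul]
      have : ‖√p.2 ^ 4‖ = p.2 ^ 2 := by
        rw [show 4 = 2 * 2 by norm_num, pow_mul, Real.sq_sqrt hp.le]
        simp
      rw [this, mul_comm]
      gcongr
    · simp only [norm_zero]; positivity
  filter_upwards [hb.eventually_nhds, tendsto_sqrt_pair.eventually hΦd.ev_diff] with p hbp hd
  rcases lt_trichotomy p.2 0 with hp | hp | hp
  · have e1 : E0 (Theta Φ) p = 0 := by simp [E0, hp.le]
    rw [e1]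
    have e2 : E0 Φ =ᶠ[𝓝 p] fun _ => 0 := by
      filter_upwards [continuous_snd.continuousAt.eventually (gt_mem_nhds hp)] with z hz
      have : z.2 < 0 := hz
      simp [E0, this.le]
    exact (hasFDerivAt_const (0 : F) p).congr_of_eventuallyEq e2
  · have e1 : E0 (Theta Φ) p = 0 := by simp [E0, hp]
    rw [e1]
    refine Asymptotics.IsBigO.hasFDerivAt (n := 2) ?_ (by norm_num)
    refine Asymptotics.IsBigO.of_bound |C| ?_
    filter_upwards [hbp] with z hz
    refine hz.trans ?_
    have : |z.2| ≤ ‖z - p‖ := by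
      have := norm_snd_le (z - p)
      simpa [hp] using this
    rw [norm_pow, norm_norm, ← sq_abs z.2]
    gcongr
    exact le_abs_self C
  · have e1 : E0 (Theta Φ) p = (fderiv ℝ Φ (p.1, √p.2)).comp (Msig (√p.2)) := by
      simp [E0, hp, Theta]
    rw [e1]
    have e2 : E0 Φ =ᶠ[𝓝 p] fun z => Φ (z.1, √z.2) := by
      filter_upwards [continuous_snd.continuousAt.eventually (lt_mem_nhds hp)] with z hz
      have : 0 < z.2 := hz
      simp [E0, this]
    refine HasFDerivAt.congr_of_eventuallyEq ?_ e2
    have e3 : HasFDerivAt (fun z : X × ℝ => (z.1, √z.2)) (Msig (√p.2)) p := by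
      have := (hasFDerivAt_fst (𝕜 := ℝ) (p := p)).prodMk
        ((hasFDerivAt_snd (𝕜 := ℝ) (p := p)).sqrt hp.ne')
      exact this
    exact HasFDerivAt.comp p (g := Φ) hd.hasFDerivAt e3

lemma E0_contDiffAt (n : ℕ) : ∀ {F : Type} [NormedAddCommGroup F] [NormedSpace ℝ F]
    {Φ : X × ℝ → F}, Flat Φ → ContDiffAt ℝ n (E0 Φ) 0 := by
  induction n with
  | zero =>
    intro F _ _ Φ h
    rw [Nat.cast_zero, contDiffAt_zero]
    refine ⟨_, E0_hasFDerivAt h, fun p hp => ?_⟩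
    exact (HasFDerivAt.continuousAt hp).continuousWithinAt
  | succ n ih =>
    intro F _ _ Φ h
    rw [show ((n + 1 : ℕ) : WithTop ℕ∞) = (n : WithTop ℕ∞) + 1 by simp,
      contDiffAt_succ_iff_hasFDerivAt]
    exact ⟨E0 (Theta Φ), ⟨_, E0_hasFDerivAt h, fun p hp => hp⟩, ih h.theta⟩

lemma E0_Sm {F : Type} [NormedAddCommGroup F] [NormedSpace ℝ F]
    {Φ : X × ℝ → F} (h : Flat Φ) : Sm (E0 Φ) := Sm_iff.2 fun n => E0_contDiffAt n h

lemma tendsto_neg_pair : Tendsto (fun p : X × ℝ => (p.1, -p.2)) (𝓝 0) (𝓝 0) := by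
  have h : Continuous (fun p : X × ℝ => (p.1, -p.2)) := by fun_prop
  simpa [← Prod.zero_eq_mk] using h.tendsto 0

lemma Sm.neg_pair {f : X × ℝ → ℝ} (hf : Sm f) : Sm (fun p : X × ℝ => f (p.1, -p.2)) :=
  hf.comp (f := fun p : X × ℝ => (p.1, -p.2))
    (contDiffAt_fst.prodMk contDiffAt_snd.neg) (by simp)

lemma Sm.sq_pair {f : X × ℝ → ℝ} (hf : Sm f) : Sm (fun p : X × ℝ => f (p.1, p.2 ^ 2)) :=
  hf.comp (f := fun p : X × ℝ => (p.1, p.2 ^ 2))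
    (contDiffAt_fst.prodMk (contDiffAt_snd.pow 2)) (by simp)

lemma even_step {S : X × ℝ → ℝ} (hS : Sm S ∧ ∀ x s, S (x, -s) = S (x, s)) :
    ∃ S' : X × ℝ → ℝ, (Sm S' ∧ ∀ x s, S' (x, -s) = S' (x, s)) ∧
      ∀ᶠ p in 𝓝 (0 : X × ℝ), S p = S (p.1, 0) + p.2 ^ 2 * S' p := by
  obtain ⟨g, hg, h1⟩ := hadamard hS.1
  obtain ⟨g2, hg2, h2⟩ := hadamard hg
  refine ⟨fun p => (g2 p + g2 (p.1, -p.2)) / 2,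
    ⟨ContDiffAt.div_const (ContDiffAt.add hg2 hg2.neg_pair) 2, ?_⟩, ?_⟩
  · intro x s
    simp only [neg_neg]
    ring
  · filter_upwards [h1, h2, tendsto_neg_pair.eventually h1, tendsto_neg_pair.eventually h2]
      with p a b c d
    have := hS.2 p.1 p.2
    rw [b] at a
    rw [d] at c
    linear_combination (1 / 2) * a + (1 / 2) * c - (1 / 2) * this

lemma whitney_even {S : X × ℝ → ℝ} (hS : Sm S ∧ ∀ x s, S (x, -s) = S (x, s)) :
    ∃ E : X × ℝ → ℝ, Sm E ∧ ∀ᶠ p in 𝓝 (0 : X × ℝ), S p = E (p.1, p.2 ^ 2) := by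
  let A := {S : X × ℝ → ℝ // Sm S ∧ ∀ x s, S (x, -s) = S (x, s)}
  have hstep : ∀ S : A, ∃ S' : A,
      ∀ᶠ p in 𝓝 (0 : X × ℝ), S.1 p = S.1 (p.1, 0) + p.2 ^ 2 * S'.1 p := by
    intro S
    obtain ⟨S', h, h'⟩ := even_step S.2
    exact ⟨⟨S', h⟩, h'⟩
  choose nx hnx using hstep
  let s : ℕ → A := fun n => nx^[n] ⟨S, hS⟩
  have hs : ∀ n, ∀ᶠ p in 𝓝 (0 : X × ℝ), (s n).1 p = (s n).1 (p.1, 0) + p.2 ^ 2 * (s (n + 1)).1 p := by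
    intro n
    have : s (n + 1) = nx (s n) := Function.iterate_succ_apply' nx n _
    rw [this]
    exact hnx (s n)
  obtain ⟨R, hR, hRs⟩ := borel_sum (fun n x => (s n).1 (x, 0)) (fun n =>
    (s n).2.1.comp (f := fun x : X => (x, (0 : ℝ))) (contDiffAt_id.prodMk contDiffAt_const) rfl)
  have tsq : Tendsto (fun p : X × ℝ => (p.1, p.2 ^ 2)) (𝓝 0) (𝓝 0) := by
    have h : Continuous (fun p : X × ℝ => (p.1, p.2 ^ 2)) := by fun_prop
    simpa [← Prod.zero_eq_mk] using h.tendsto 0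
  let Φ : X × ℝ → ℝ := fun p => S p - R 0 (p.1, p.2 ^ 2)
  have hΦN : ∀ N : ℕ, ∀ᶠ p in 𝓝 (0 : X × ℝ),
      Φ p = p.2 ^ (2 * N) * ((s N).1 p - R N (p.1, p.2 ^ 2)) := by
    intro N
    induction N with
    | zero => exact Eventually.of_forall fun p => by simp [Φ, s]
    | succ N ih =>
      filter_upwards [ih, hs N, tsq.eventually (hRs N)] with p h1 h2 h3
      rw [h1, h2, h3]
      ring
  have hflat : Flat Φ := by
    intro N
    refine ⟨fun p => p.2 ^ N * ((s N).1 p - R N (p.1, p.2 ^ 2)), ?_, ?_⟩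
    · exact ContDiffAt.mul (contDiffAt_snd.pow N) (ContDiffAt.sub (s N).2.1 (hR N).sq_pair)
    · filter_upwards [hΦN N] with p hp
      rw [hp, smul_eq_mul]
      ring
  refine ⟨fun p => R 0 p + E0 Φ p, ContDiffAt.add (hR 0) (E0_Sm hflat), ?_⟩
  filter_upwards [hΦN 1] with p hp
  have : E0 Φ (p.1, p.2 ^ 2) = Φ p := by
    unfold E0
    simp only
    rcases lt_trichotomy p.2 0 with h | h | h
    · rw [if_pos (by nlinarith [sq_pos_of_neg h]), Real.sqrt_sq_eq_abs, abs_of_neg h]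
      simp only [Φ, hS.2, even_two, Even.neg_pow]
    · rw [hp]; simp [h]
    · rw [if_pos (by positivity), Real.sqrt_sq_eq_abs, abs_of_pos h]
  rw [this]
  simp [Φ]

lemma whitney {φ : X × ℝ → ℝ} (hφ : Sm φ) :
    ∃ E O : X × ℝ → ℝ, Sm E ∧ Sm O ∧
      ∀ᶠ p in 𝓝 (0 : X × ℝ), φ p = E (p.1, p.2 ^ 2) + p.2 * O (p.1, p.2 ^ 2) := by
  obtain ⟨E, hE, h1⟩ := whitney_even (S := fun p => (φ p + φ (p.1, -p.2)) / 2)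
    ⟨ContDiffAt.div_const (ContDiffAt.add hφ hφ.neg_pair) 2, fun x s => by simp only [neg_neg]; ring⟩
  obtain ⟨g, hg, h2⟩ := hadamard hφ
  obtain ⟨O, hO, h3⟩ := whitney_even (S := fun p => (g p + g (p.1, -p.2)) / 2)
    ⟨ContDiffAt.div_const (ContDiffAt.add hg hg.neg_pair) 2, fun x s => by simp only [neg_neg]; ring⟩
  refine ⟨E, O, hE, hO, ?_⟩
  filter_upwards [h1, h2, h3, tendsto_neg_pair.eventually h2] with p a b c d
  rw [← a, ← c]
  linear_combination (1 / 2) * b - (1 / 2) * d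

end flat

set_option linter.unusedSectionVars false


section descent

lemma HD {f : ℝ × ℝ → ℝ} (hf : Sm f) {c : ℝ → ℝ} (hc : Sm c) (hc0 : c 0 = 0)
    (h : ∀ᶠ u in 𝓝 (0 : ℝ), u ≠ 0 → f (u, c u) = 0) :
    ∃ g, Sm g ∧ ∀ᶠ p in 𝓝 (0 : ℝ × ℝ), f p = (p.2 - c p.1) * g p := by
  have hc1 : Sm (fun p : ℝ × ℝ => c p.1) := hc.comp (f := fun p : ℝ × ℝ => p.1) contDiffAt_fst rfl
  have hF : Sm (fun p : ℝ × ℝ => f (p.1, p.2 + c p.1)) :=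
    hf.comp (f := fun p : ℝ × ℝ => (p.1, p.2 + c p.1))
      (contDiffAt_fst.prodMk (contDiffAt_snd.add hc1)) (by simp [hc0])
  obtain ⟨G, hG, hFG⟩ := hadamard hF
  have hsh : Sm (fun p : ℝ × ℝ => (p.1, p.2 - c p.1)) :=
    contDiffAt_fst.prodMk (contDiffAt_snd.sub hc1)
  refine ⟨fun p => G (p.1, p.2 - c p.1), hG.comp hsh (by simp [hc0]), ?_⟩
  have hcont : ContinuousAt f 0 := hf.continuousAt
  have hcc : ContinuousAt c 0 := hc.continuousAt
  have h0 : f 0 = 0 := by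
    have t1 : Tendsto (fun u : ℝ => f (u, c u)) (𝓝 0) (𝓝 (f 0)) := by
      have : Tendsto (fun u : ℝ => (u, c u)) (𝓝 0) (𝓝 0) := by
        have := (continuousAt_id (x := (0:ℝ))).prodMk hcc
        simpa [ContinuousAt, hc0, ← Prod.zero_eq_mk] using this
      exact hcont.tendsto.comp this
    have t2 : Tendsto (fun u : ℝ => f (u, c u)) (𝓝[≠] 0) (𝓝 0) := by
      refine tendsto_const_nhds.congr' ?_
      filter_upwards [eventually_nhdsWithin_of_eventually_nhds h, self_mem_nhdsWithin] with u a b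
      exact (a b).symm
    exact tendsto_nhds_unique (t1.mono_left nhdsWithin_le_nhds) t2
  have tsh : Tendsto (fun p : ℝ × ℝ => (p.1, p.2 - c p.1)) (𝓝 0) (𝓝 0) := by
    have : ContinuousAt (fun p : ℝ × ℝ => (p.1, p.2 - c p.1)) 0 := hsh.continuousAt
    simpa [ContinuousAt, hc0, ← Prod.zero_eq_mk] using this
  filter_upwards [tsh.eventually hFG, (continuous_fst.tendsto (0 : ℝ × ℝ)).eventually h] with p h1 h2
  simp only [sub_add_cancel, zero_add] at h1
  rw [show f p = f (p.1, p.2) from rfl, h1]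
  have : f (p.1, c p.1) = 0 := by
    by_cases hp : p.1 = 0
    · rw [hp, hc0]; exact h0
    · exact h2 hp
  rw [this, zero_add]

noncomputable def tau (u α : ℝ) : ℝ := u / 3 * (2 * Real.cos α - 1)

lemma tau_abs (u α : ℝ) : |tau u α| ≤ |u| := by
  unfold tau
  rw [abs_mul, abs_div]
  have : |2 * Real.cos α - 1| ≤ 3 := by
    rw [abs_le]; constructor <;> linarith [Real.neg_one_le_cos α, Real.cos_le_one α]
  have h3 : |(3:ℝ)| = 3 := by norm_num
  rw [h3]
  nlinarith [abs_nonneg u]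

lemma ev_tau {P : ℝ × ℝ → Prop} (h : ∀ᶠ p in 𝓝 (0 : ℝ × ℝ), P p) :
    ∀ᶠ u in 𝓝 (0 : ℝ), ∀ α, P (u, tau u α) := by
  obtain ⟨ε, hε, hP⟩ := Metric.eventually_nhds_iff.1 h
  filter_upwards [Metric.ball_mem_nhds (0:ℝ) hε] with u hu α
  apply hP
  have hu' : |u| < ε := by simpa using hu
  rw [dist_zero_right, Prod.norm_def]
  exact max_lt hu' ((tau_abs u α).trans_lt hu')

def FC (A : ℝ × ℝ → ℝ) : Prop :=
  ∀ᶠ u in 𝓝 (0 : ℝ), ∀ α, A (u, tau u α) = A (u, tau u (α + 2 * Real.pi / 3))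

lemma cos_third (α : ℝ) : Real.cos (α + 2 * Real.pi / 3) =
    -(1/2) * Real.cos α - √3 / 2 * Real.sin α := by
  rw [Real.cos_add, show 2 * Real.pi / 3 = Real.pi - Real.pi / 3 by ring, Real.cos_pi_sub,
    Real.sin_pi_sub, Real.cos_pi_div_three, Real.sin_pi_div_three]
  ring

lemma sin_third (α : ℝ) : Real.sin (α + 2 * Real.pi / 3) =
    -(1/2) * Real.sin α + √3 / 2 * Real.cos α := by
  rw [Real.sin_add, show 2 * Real.pi / 3 = Real.pi - Real.pi / 3 by ring, Real.cos_pi_sub,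
    Real.sin_pi_sub, Real.cos_pi_div_three, Real.sin_pi_div_three]
  ring

lemma cos3_third (α : ℝ) : Real.cos (3 * (α + 2 * Real.pi / 3)) = Real.cos (3 * α) := by
  rw [show 3 * (α + 2 * Real.pi / 3) = 3 * α + 2 * Real.pi by ring, Real.cos_add_two_pi]

lemma sin3_third (α : ℝ) : Real.sin (3 * (α + 2 * Real.pi / 3)) = Real.sin (3 * α) := by
  rw [show 3 * (α + 2 * Real.pi / 3) = 3 * α + 2 * Real.pi by ring, Real.sin_add_two_pi]

lemma Tg_tau (u α : ℝ) : Tg (u, tau u α) = 2 * u ^ 3 / 27 * (1 + Real.cos (3 * α)) := by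
  unfold Tg tau
  rw [Real.cos_three_mul]
  ring

lemma exists_angle {c d : ℝ} (h : c ^ 2 + d ^ 2 = 1) : ∃ α, Real.cos α = c ∧ Real.sin α = d := by
  have hn : ‖(⟨c, d⟩ : ℂ)‖ = 1 := by
    rw [Complex.norm_def, Complex.normSq_mk, ← sq, ← sq, h, Real.sqrt_one]
  have h0 : (⟨c, d⟩ : ℂ) ≠ 0 := by
    intro h; rw [h] at hn; simp at hn
  refine ⟨Complex.arg ⟨c, d⟩, ?_, ?_⟩
  · rw [Complex.cos_arg h0, hn]; simp
  · rw [Complex.sin_arg, hn]; simp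

lemma fiber_param {u t t' : ℝ} (hT : Tg (u, t) = Tg (u, t')) (hne : t ≠ t') :
    ∃ α, t = tau u α ∧ t' = tau u (α + 2 * Real.pi / 3) := by
  have h1 : t ^ 2 + t * t' + t' ^ 2 + u * (t + t') = 0 := by
    have : (t - t') * (t ^ 2 + t * t' + t' ^ 2 + u * (t + t')) = 0 := by
      unfold Tg at hT; simp only at hT; linear_combination hT
    exact (mul_eq_zero.1 this).resolve_left (sub_ne_zero.2 hne)
  have hu : u ≠ 0 := by
    rintro rfl
    have h2 : (t + t') ^ 2 + t ^ 2 + t' ^ 2 = 0 := by linear_combination 2 * h1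
    have ht : t = 0 := by nlinarith [sq_nonneg (t + t'), sq_nonneg t, sq_nonneg t']
    have ht' : t' = 0 := by nlinarith [sq_nonneg (t + t'), sq_nonneg t, sq_nonneg t']
    exact hne (ht.trans ht'.symm)
  have s3 : √3 ^ 2 = (3:ℝ) := Real.sq_sqrt (by norm_num)
  have s0 : √3 ≠ (0:ℝ) := by positivity
  set c := (3 * t / u + 1) / 2 with hc
  set c' := (3 * t' / u + 1) / 2 with hc'
  have ht : t = u / 3 * (2 * c - 1) := by rw [hc]; field_simp; ring
  have ht' : t' = u / 3 * (2 * c' - 1) := by rw [hc']; field_simp; ring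
  have h2 : c ^ 2 + c * c' + c' ^ 2 = 3 / 4 := by
    have : u ^ 2 * (c ^ 2 + c * c' + c' ^ 2 - 3 / 4) = 0 := by
      rw [ht, ht'] at h1
      linear_combination (9 / 4) * h1
    have := (mul_eq_zero.1 this).resolve_left (by positivity)
    linarith
  obtain ⟨α, ha, hb⟩ := exists_angle (c := c) (d := -(2 * c' + c) / √3) (by
    rw [div_pow _ (√3), s3]; linear_combination (4 / 3) * h2)
  refine ⟨α, by rw [tau, ha]; exact ht, ?_⟩
  rw [tau, cos_third, ha, hb, ht']
  field_simp
  ring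

lemma FC.eq {A : ℝ × ℝ → ℝ} (h : FC A) : ∀ᶠ u in 𝓝 (0 : ℝ), ∀ t t',
    Tg (u, t) = Tg (u, t') → A (u, t) = A (u, t') := by
  filter_upwards [h] with u hu t t' hT
  by_cases hne : t = t'
  · rw [hne]
  · obtain ⟨α, rfl, rfl⟩ := fiber_param hT hne
    exact hu α

lemma dense_sin3 : Dense {α : ℝ | Real.sin (3 * α) ≠ 0} := by
  have : {α : ℝ | Real.sin (3 * α) = 0}.Countable := by
    refine (Set.countable_range (fun n : ℤ => (n : ℝ) * Real.pi / 3)).mono ?_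
    intro α hα
    obtain ⟨n, hn⟩ := Real.sin_eq_zero_iff.1 hα
    exact ⟨n, by simp only; linarith⟩
  exact this.dense_compl ℝ

lemma cont_tau (u : ℝ) : Continuous (tau u) := by unfold tau; fun_prop

lemma cont_A_tau {A : ℝ × ℝ → ℝ} {u : ℝ} (h : ∀ α, ContinuousAt A (u, tau u α)) :
    Continuous fun α => A (u, tau u α) := by
  rw [continuous_iff_continuousAt]
  intro α
  have : ContinuousAt (fun α => (u, tau u α)) α :=
    (continuous_const.prodMk (cont_tau u)).continuousAt
  exact ContinuousAt.comp (g := A) (h α) this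

lemma FC_of_sin {A : ℝ × ℝ → ℝ} (hA : Sm A)
    (h : ∀ᶠ u in 𝓝 (0 : ℝ), u ≠ 0 → ∀ α, Real.sin (3 * α) ≠ 0 →
      A (u, tau u α) = A (u, tau u (α + 2 * Real.pi / 3))) : FC A := by
  filter_upwards [h, ev_tau hA.ev_cont] with u h1 h2
  by_cases hu : u = 0
  · intro α; simp [hu, tau]
  have c1 := cont_A_tau h2
  have c2 : Continuous fun α => A (u, tau u (α + 2 * Real.pi / 3)) :=
    c1.comp (continuous_id.add continuous_const)
  intro α
  exact congrFun (c1.ext_on dense_sin3 c2 (fun α hα => h1 hu α hα)) α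

lemma hasDerivAt_tau_a (u α : ℝ) : HasDerivAt (tau u) (-(2 * u / 3) * Real.sin α) α := by
  unfold tau
  have := (((Real.hasDerivAt_cos α).const_mul 2).sub_const 1).const_mul (u / 3)
  refine this.congr_deriv (by ring)

lemma hasDerivAt_tau_u (u α : ℝ) :
    HasDerivAt (fun u => tau u α) ((2 * Real.cos α - 1) / 3) u := by
  unfold tau
  have := ((hasDerivAt_id u).div_const 3).mul_const (2 * Real.cos α - 1)
  refine this.congr_deriv (by ring)

noncomputable def du (f : ℝ × ℝ → ℝ) (p : ℝ × ℝ) : ℝ := fderiv ℝ f p (1, 0)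

lemma Sm_du {f : ℝ × ℝ → ℝ} (hf : Sm f) : Sm (du f) :=
  ContDiffAt.clm_apply hf.fderiv contDiffAt_const

lemma fderiv_split (f : ℝ × ℝ → ℝ) (p : ℝ × ℝ) (a b : ℝ) :
    fderiv ℝ f p (a, b) = a * du f p + b * dt f p := by
  have : ((a, b) : ℝ × ℝ) = a • ((1:ℝ), (0:ℝ)) + b • ((0:ℝ), (1:ℝ)) := by simp
  rw [this, map_add, map_smul, map_smul]
  rfl

lemma FC.dalpha {A : ℝ × ℝ → ℝ} (hA : Sm A) (h : FC A) : ∀ᶠ u in 𝓝 (0 : ℝ), u ≠ 0 → ∀ α,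
    dt A (u, tau u α) * Real.sin α =
      dt A (u, tau u (α + 2 * Real.pi / 3)) * Real.sin (α + 2 * Real.pi / 3) := by
  filter_upwards [h, ev_tau hA.ev_diff] with u h1 h2 hu α
  have key : ∀ α, HasDerivAt (fun α => A (u, tau u α))
      (-(2 * u / 3) * (dt A (u, tau u α) * Real.sin α)) α := by
    intro α
    have e := (h2 α).hasFDerivAt.comp_hasDerivAt α
      ((hasDerivAt_const α u).prodMk (hasDerivAt_tau_a u α))
    refine e.congr_deriv ?_
    rw [fderiv_split]; ring
  have k2 : HasDerivAt (fun α => A (u, tau u (α + 2 * Real.pi / 3))) _ α :=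
    (key (α + 2 * Real.pi / 3)).comp_add_const α (2 * Real.pi / 3)
  have : (fun α => A (u, tau u α)) = fun α => A (u, tau u (α + 2 * Real.pi / 3)) := funext h1
  have := (this ▸ key α).unique k2
  have h3 : -(2 * u / 3) ≠ 0 := by
    intro h; apply hu; linarith
  exact mul_left_cancel₀ h3 this

lemma FC.du_eq {A : ℝ × ℝ → ℝ} (hA : Sm A) (h : FC A) : ∀ᶠ u in 𝓝 (0 : ℝ), ∀ α,
    du A (u, tau u α) + dt A (u, tau u α) * ((2 * Real.cos α - 1) / 3) =
    du A (u, tau u (α + 2 * Real.pi / 3)) + dt A (u, tau u (α + 2 * Real.pi / 3)) *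
      ((2 * Real.cos (α + 2 * Real.pi / 3) - 1) / 3) := by
  filter_upwards [h.eventually_nhds, ev_tau hA.ev_diff] with u h1 h2 α
  have key : ∀ α, HasDerivAt (fun u => A (u, tau u α))
      (du A (u, tau u α) + dt A (u, tau u α) * ((2 * Real.cos α - 1) / 3)) u := by
    intro α
    have e := (h2 α).hasFDerivAt.comp_hasDerivAt u
      ((hasDerivAt_id u).prodMk (hasDerivAt_tau_u u α))
    refine e.congr_deriv ?_
    rw [fderiv_split]; ring
  refine (key α).unique ((key (α + 2 * Real.pi / 3)).congr_of_eventuallyEq ?_)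
  filter_upwards [h1] with v hv using hv α

lemma FC.derivs {A : ℝ × ℝ → ℝ} (hA : Sm A) (h : FC A) :
    ∃ A1 A2 : ℝ × ℝ → ℝ, (Sm A1 ∧ FC A1) ∧ (Sm A2 ∧ FC A2) ∧
      ∀ᶠ p in 𝓝 (0 : ℝ × ℝ), dt A p = p.2 * (3 * p.2 + 2 * p.1) * A1 p ∧
        du A p = A2 p + p.2 ^ 2 * A1 p := by
  have s3 : √3 ≠ (0:ℝ) := by positivity
  have hda := FC.dalpha hA h
  have hz : ∀ᶠ u in 𝓝 (0 : ℝ), u ≠ 0 → dt A (u, 0) = 0 := by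
    filter_upwards [hda] with u h1 hu
    have := h1 hu Real.pi
    have e : tau u (Real.pi + 2 * Real.pi / 3) = 0 := by
      rw [tau, cos_third]; simp
    rw [sin_third, e] at this
    simpa using this
  have hz2 : ∀ᶠ u in 𝓝 (0 : ℝ), u ≠ 0 → dt A (u, -(2/3) * u) = 0 := by
    filter_upwards [hda] with u h1 hu
    have := h1 hu 0
    have e : tau u (0 + 2 * Real.pi / 3) = -(2/3) * u := by
      rw [tau, cos_third]; simp; ring
    rw [sin_third, e] at this
    simpa using this
  obtain ⟨g, hg, h1⟩ := HD (Sm_dt hA) (c := fun _ => 0) contDiffAt_const rfl hz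
  have hcS : Sm (fun u : ℝ => -(2/3) * u) := contDiffAt_const.mul contDiffAt_id
  have tcu : Tendsto (fun u : ℝ => (u, -(2/3) * u)) (𝓝 0) (𝓝 0) := by
    have h : Continuous (fun u : ℝ => (u, -(2/3) * u)) := by fun_prop
    simpa [← Prod.zero_eq_mk] using h.tendsto 0
  obtain ⟨g2, hg2, h2⟩ := HD hg hcS (by simp) (by
    filter_upwards [hz2, tcu.eventually h1] with u a b hu
    rw [a hu] at b
    have : -(2/3) * u - 0 ≠ 0 := by intro h; apply hu; linarith
    exact (mul_eq_zero.1 b.symm).resolve_left this)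
  have hA1 : Sm (fun p => g2 p / 3) := hg2.div_const 3
  have e1 : ∀ᶠ p in 𝓝 (0 : ℝ × ℝ), dt A p = p.2 * (3 * p.2 + 2 * p.1) * (g2 p / 3) := by
    filter_upwards [h1, h2] with p a b
    rw [a, b]; ring
  set A1 : ℝ × ℝ → ℝ := fun p => g2 p / 3 with hA1d
  replace e1 : ∀ᶠ p in 𝓝 (0 : ℝ × ℝ), dt A p = p.2 * (3 * p.2 + 2 * p.1) * A1 p := e1
  have hA2 : Sm (fun p : ℝ × ℝ => du A p - p.2 ^ 2 * A1 p) :=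
    ContDiffAt.sub (Sm_du hA) ((contDiffAt_snd.pow 2).mul hA1)
  have FC1 : FC A1 := by
    refine FC_of_sin hA1 ?_
    filter_upwards [hda, ev_tau e1] with u a b hu α hs
    have := a hu α
    rw [b, b] at this
    have key : ∀ α, tau u α * (3 * tau u α + 2 * u) * A1 (u, tau u α) * Real.sin α =
        u ^ 2 / 3 * Real.sin (3 * α) * A1 (u, tau u α) := by
      intro α
      have : Real.sin (3 * α) = Real.sin α * (4 * Real.cos α ^ 2 - 1) := by
        rw [Real.sin_three_mul]
        linear_combination (-4 * Real.sin α) * Real.sin_sq_add_cos_sq α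
      rw [this]
      generalize A1 (u, tau u α) = z
      unfold tau
      ring
    rw [key, key, sin3_third] at this
    refine mul_left_cancel₀ ?_ this
    positivity
  refine ⟨A1, fun p => du A p - p.2 ^ 2 * A1 p, ⟨hA1, FC1⟩, ⟨hA2, ?_⟩, ?_⟩
  · filter_upwards [FC.du_eq hA h, FC1, ev_tau e1] with u a b c α
    have key : ∀ α, du A (u, tau u α) - (tau u α) ^ 2 * A1 (u, tau u α) =
        (du A (u, tau u α) + dt A (u, tau u α) * ((2 * Real.cos α - 1) / 3)) -
          2 * u ^ 2 / 9 * (1 + Real.cos (3 * α)) * A1 (u, tau u α) := by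
      intro α
      rw [c, Real.cos_three_mul]
      generalize A1 (u, tau u α) = z
      generalize du A (u, tau u α) = w
      unfold tau
      ring
    rw [key, key, a, cos3_third, b]
  · filter_upwards [e1] with p a
    exact ⟨a, by ring⟩

end descent

set_option linter.unusedSectionVars false

section descent2

lemma exists_root (p : ℝ × ℝ) : ∃ t, Tg (p.1, t) = p.2 := by
  have hc : Continuous fun t => Tg (p.1, t) := by unfold Tg; fun_prop
  have hu := abs_nonneg p.1
  have hy := abs_nonneg p.2
  have hu1 := neg_abs_le p.1
  have hu2 := le_abs_self p.1
  have hy1 := neg_abs_le p.2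
  have hy2 := le_abs_self p.2
  have := mem_range_of_exists_le_of_exists_ge hc (c := p.2)
    ⟨-(1 + |p.1| + |p.2|), by
      unfold Tg; simp only
      nlinarith [mul_nonneg (sq_nonneg (1 + |p.1| + |p.2|)) (by linarith : 0 ≤ |p.1| + |p.2| - p.1),
        mul_nonneg hu hy, sq_nonneg |p.1|, sq_nonneg |p.2|]⟩
    ⟨1 + |p.1| + |p.2|, by
      unfold Tg; simp only
      nlinarith [mul_nonneg (sq_nonneg (1 + |p.1| + |p.2|)) (by linarith : 0 ≤ |p.1| + |p.2| + p.1),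
        mul_nonneg hu hy, sq_nonneg |p.1|, sq_nonneg |p.2|]⟩
  obtain ⟨t, ht⟩ := this
  exact ⟨t, ht⟩

noncomputable def rho (p : ℝ × ℝ) : ℝ := (exists_root p).choose

lemma rho_spec (p : ℝ × ℝ) : Tg (p.1, rho p) = p.2 := (exists_root p).choose_spec

lemma ev_root {P : ℝ × ℝ → Prop} (h : ∀ᶠ p in 𝓝 (0 : ℝ × ℝ), P p) :
    ∀ᶠ p in 𝓝 (0 : ℝ × ℝ), ∀ t, Tg (p.1, t) = p.2 → P (p.1, t) := by
  obtain ⟨ε, hε, hP⟩ := Metric.eventually_nhds_iff.1 h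
  have e1 : ∀ᶠ p in 𝓝 (0 : ℝ × ℝ), |p.1| < ε / 2 := by
    have : Continuous fun p : ℝ × ℝ => |p.1| := by fun_prop
    exact this.continuousAt.eventually (gt_mem_nhds (by simpa using hε))
  have e2 : ∀ᶠ p in 𝓝 (0 : ℝ × ℝ), |p.2| < ε ^ 3 / 2 := by
    have : Continuous fun p : ℝ × ℝ => |p.2| := by fun_prop
    exact this.continuousAt.eventually (gt_mem_nhds (by simp only [Prod.snd_zero, abs_zero]; positivity))
  filter_upwards [e1, e2] with p h1 h2 t ht
  apply hP
  rw [dist_zero_right, Prod.norm_def]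
  refine max_lt (by simpa using h1.trans (by linarith)) ?_
  simp only [Real.norm_eq_abs]
  by_contra hcon
  push Not at hcon
  have a1 : |p.2| = t ^ 2 * |t + p.1| := by
    rw [← ht, ← abs_of_nonneg (sq_nonneg t), ← abs_mul]
    congr 1
    unfold Tg; simp only; ring
  have a2 : ε / 2 ≤ |t + p.1| := by
    have := abs_sub_abs_le_abs_sub t (-p.1)
    rw [abs_neg, sub_neg_eq_add] at this
    linarith
  have a3 : ε ^ 2 ≤ t ^ 2 := by rw [← sq_abs t]; gcongr
  have : ε ^ 2 * (ε / 2) ≤ t ^ 2 * |t + p.1| := by gcongr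
  rw [a1] at h2
  nlinarith

noncomputable def bar (A : ℝ × ℝ → ℝ) (p : ℝ × ℝ) : ℝ := A (p.1, rho p)

lemma bar_eq {A : ℝ × ℝ → ℝ} (h : FC A) : ∀ᶠ u in 𝓝 (0 : ℝ), ∀ t, bar A (u, Tg (u, t)) = A (u, t) := by
  filter_upwards [h.eq] with u hu t
  exact hu _ _ (rho_spec (u, Tg (u, t)))

lemma bar_eq2 {A : ℝ × ℝ → ℝ} (h : FC A) : ∀ᶠ p in 𝓝 (0 : ℝ × ℝ), A p = bar A (p.1, Tg p) := by
  filter_upwards [(continuous_fst.tendsto (0 : ℝ × ℝ)).eventually (bar_eq h)] with p hp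
  exact (hp p.2).symm

lemma simple_root {p : ℝ × ℝ} (hp : p ≠ 0) :
    ∃ t, Tg (p.1, t) = p.2 ∧ t * (3 * t + 2 * p.1) ≠ 0 := by
  obtain ⟨t, ht⟩ := exists_root p
  by_cases h : t * (3 * t + 2 * p.1) ≠ 0
  · exact ⟨t, ht, h⟩
  push Not at h
  have hu : p.1 ≠ 0 := by
    intro hu
    rw [hu] at h
    have t0 : t = 0 := by nlinarith
    apply hp
    ext
    · exact hu
    · rw [← ht, t0]; simp [Tg]
  rcases mul_eq_zero.1 h with h | h
  · refine ⟨-p.1, ?_, ?_⟩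
    · rw [← ht, h]; simp [Tg]; ring
    · have : -p.1 * (3 * -p.1 + 2 * p.1) = p.1 ^ 2 := by ring
      rw [this]; positivity
  · refine ⟨p.1 / 3, ?_, ?_⟩
    · rw [← ht, show t = -2 * p.1 / 3 by linarith]; simp [Tg]; ring
    · have : p.1 / 3 * (3 * (p.1 / 3) + 2 * p.1) = p.1 ^ 2 := by ring
      rw [this]; positivity

noncomputable def Leq (a m : ℝ) (hm : m ≠ 0) : (ℝ × ℝ) ≃L[ℝ] (ℝ × ℝ) :=
  ContinuousLinearEquiv.equivOfInverse
    ((ContinuousLinearMap.fst ℝ ℝ ℝ).prod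
      (a • ContinuousLinearMap.fst ℝ ℝ ℝ + m • ContinuousLinearMap.snd ℝ ℝ ℝ))
    ((ContinuousLinearMap.fst ℝ ℝ ℝ).prod
      (m⁻¹ • (ContinuousLinearMap.snd ℝ ℝ ℝ - a • ContinuousLinearMap.fst ℝ ℝ ℝ)))
    (by intro x; ext <;> simp [hm]) (by intro x; ext <;> simp [hm])

noncomputable def dbar (A1 A2 : ℝ × ℝ → ℝ) (p : ℝ × ℝ) : (ℝ × ℝ) →L[ℝ] ℝ :=
  bar A2 p • ContinuousLinearMap.fst ℝ ℝ ℝ + bar A1 p • ContinuousLinearMap.snd ℝ ℝ ℝ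

lemma bar_hasFDerivAt_ne {A A1 A2 : ℝ × ℝ → ℝ} (hA : Sm A) (h : FC A) (h1 : FC A1) (h2 : FC A2)
    (hd : ∀ᶠ p in 𝓝 (0 : ℝ × ℝ), dt A p = p.2 * (3 * p.2 + 2 * p.1) * A1 p ∧
        du A p = A2 p + p.2 ^ 2 * A1 p) :
    ∀ᶠ p in 𝓝 (0 : ℝ × ℝ), p ≠ 0 → HasFDerivAt (bar A) (dbar A1 A2 p) p := by
  have tf := continuous_fst.tendsto (0 : ℝ × ℝ)
  filter_upwards [ev_root hd, ev_root hA.ev_diff, tf.eventually (bar_eq h).eventually_nhds,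
    tf.eventually (bar_eq h1), tf.eventually (bar_eq h2)] with p a1 a2 a3 a4 a5 hp
  obtain ⟨t, ht, hm⟩ := simple_root hp
  obtain ⟨d1, d2⟩ := a1 t ht
  have d3 := a2 t ht
  set m := t * (3 * t + 2 * p.1) with hmd
  have hg : HasStrictFDerivAt (fun q : ℝ × ℝ => (q.1, Tg q))
      ((Leq (t ^ 2) m hm : (ℝ × ℝ) ≃L[ℝ] (ℝ × ℝ)) : (ℝ × ℝ) →L[ℝ] (ℝ × ℝ)) (p.1, t) := by
    have b1 : HasStrictFDerivAt (fun q : ℝ × ℝ => q.1) (ContinuousLinearMap.fst ℝ ℝ ℝ) (p.1, t) :=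
      hasStrictFDerivAt_fst
    have b2 : HasStrictFDerivAt (fun q : ℝ × ℝ => q.2) (ContinuousLinearMap.snd ℝ ℝ ℝ) (p.1, t) :=
      hasStrictFDerivAt_snd
    have := b1.prodMk ((b2.pow 3).add (b1.mul (b2.pow 2)))
    refine this.congr_fderiv ?_
    ext <;> simp [Leq, hmd] <;> ring
  have hgp : ((p.1, t).1, Tg (p.1, t)) = p := by
    rw [ht]
  have hinv := hg.to_localInverse
  have hri := hg.eventually_right_inverse
  have hval : hg.localInverse _ _ _ p = (p.1, t) := by
    have := hg.localInverse_apply_image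
    rwa [hgp] at this
  rw [hgp] at hinv hri
  set φ := hg.localInverse (fun q : ℝ × ℝ => (q.1, Tg q)) _ _ with hφ
  have hφd : HasFDerivAt φ _ p := hinv.hasFDerivAt
  have hcomp : HasFDerivAt (fun q => A (φ q)) ((fderiv ℝ A (p.1, t)).comp
      ((Leq (t ^ 2) m hm).symm : (ℝ × ℝ) →L[ℝ] (ℝ × ℝ))) p := by
    refine HasFDerivAt.comp p (g := A) ?_ hφd
    rw [hval]; exact d3.hasFDerivAt
  have hev : bar A =ᶠ[𝓝 p] fun q => A (φ q) := by
    filter_upwards [hri, (continuous_fst.tendsto p).eventually a3] with q q1 q2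
    have e1 : (φ q).1 = q.1 := by rw [Prod.ext_iff] at q1; exact q1.1
    have e2 : Tg (φ q) = q.2 := by rw [Prod.ext_iff] at q1; exact q1.2
    have := q2 (φ q).2
    rw [← e1] at this
    change bar A ((φ q).1, Tg (φ q)) = A (φ q) at this
    rw [← this, e1, e2]
  refine (hcomp.congr_of_eventuallyEq hev).congr_fderiv ?_
  have c1 : bar A1 p = A1 (p.1, t) := by
    have := a4 t; rwa [ht] at this
  have c2 : bar A2 p = A2 (p.1, t) := by
    have := a5 t; rwa [ht] at this
  refine ContinuousLinearMap.ext fun z => ?_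
  have : ((Leq (t ^ 2) m hm).symm : (ℝ × ℝ) →L[ℝ] (ℝ × ℝ)) z = (z.1, m⁻¹ * (z.2 - t ^ 2 * z.1)) := by
    rfl
  rw [ContinuousLinearMap.comp_apply, this, fderiv_split, d1, d2]
  simp only [dbar, c1, c2, add_apply, smul_apply, smul_eq_mul,
    ContinuousLinearMap.coe_fst', ContinuousLinearMap.coe_snd']
  field_simp
  ring

lemma rho_tendsto : Tendsto (fun p : ℝ × ℝ => (p.1, rho p)) (𝓝 0) (𝓝 0) := by
  intro s hs
  have : ∀ᶠ p in 𝓝 (0 : ℝ × ℝ), p ∈ s := hs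
  exact (ev_root this).mono fun p hp => hp _ (rho_spec p)

lemma rho_zero : rho 0 = 0 := by
  have h := rho_spec 0
  simp only [Tg, Prod.fst_zero, Prod.snd_zero, zero_mul, add_zero] at h
  exact pow_eq_zero_iff (by norm_num) |>.1 h

lemma bar_cont0 {A : ℝ × ℝ → ℝ} (hA : ContinuousAt A 0) : ContinuousAt (bar A) 0 := by
  have h0 : bar A 0 = A 0 := by simp [bar, rho_zero, ← Prod.zero_eq_mk]
  unfold ContinuousAt
  rw [h0]
  exact hA.tendsto.comp rho_tendsto

lemma bar_half {f : ℝ × ℝ → ℝ} {f' : ℝ × ℝ → ((ℝ × ℝ) →L[ℝ] ℝ)} {s : Set (ℝ × ℝ)} {δ : ℝ}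
    (hs : Convex ℝ s) (ho : IsOpen s) (h0 : (0 : ℝ × ℝ) ∉ s)
    (hsδ : s ⊆ Metric.ball 0 δ) (hcl : closure s ⊆ Metric.ball 0 δ)
    (hf : ContinuousAt f 0) (hf' : ContinuousAt f' 0)
    (hd : ∀ p ∈ Metric.ball (0 : ℝ × ℝ) δ, p ≠ 0 → HasFDerivAt f (f' p) p) :
    HasFDerivWithinAt f (f' 0) (closure s) 0 := by
  have hd' : ∀ p ∈ s, HasFDerivAt f (f' p) p := fun p hp =>
    hd p (hsδ hp) (fun h => h0 (h ▸ hp))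
  refine hasFDerivWithinAt_closure_of_tendsto_fderiv
    (fun p hp => (hd' p hp).differentiableAt.differentiableWithinAt) hs ho ?_ ?_
  · intro y hy
    by_cases h : y = 0
    · rw [h]; exact hf.continuousWithinAt
    · exact (hd y (hcl hy) h).continuousAt.continuousWithinAt
  · refine (hf'.tendsto.mono_left nhdsWithin_le_nhds).congr' ?_
    filter_upwards [self_mem_nhdsWithin] with p hp
    exact (hd' p hp).fderiv.symm

lemma hasFDerivAt_zero_of_punctured {f : ℝ × ℝ → ℝ} {f' : ℝ × ℝ → ((ℝ × ℝ) →L[ℝ] ℝ)}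
    (hf : ContinuousAt f 0) (hf' : ContinuousAt f' 0)
    (hd : ∀ᶠ p in 𝓝 (0 : ℝ × ℝ), p ≠ 0 → HasFDerivAt f (f' p) p) :
    HasFDerivAt f (f' 0) 0 := by
  obtain ⟨δ, hδ, hb⟩ := Metric.eventually_nhds_iff_ball.1 hd
  have key : ∀ a b : ℝ, a ∉ Set.Ioo (0:ℝ) 1 → -(δ/2) ≤ a → b ≤ δ/2 → a < b → (0:ℝ) ∉ Set.Ioo a b →
      HasFDerivWithinAt f (f' 0) (Set.Icc a b ×ˢ Set.Icc (-(δ/2)) (δ/2)) 0 := by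
    intro a b _ ha hb' hab h0
    have hc : closure (Set.Ioo a b ×ˢ Set.Ioo (-(δ/2)) (δ/2)) =
        Set.Icc a b ×ˢ Set.Icc (-(δ/2)) (δ/2) := by
      rw [closure_prod_eq, closure_Ioo hab.ne, closure_Ioo (by linarith)]
    have hcl : closure (Set.Ioo a b ×ˢ Set.Ioo (-(δ/2)) (δ/2)) ⊆ Metric.ball (0 : ℝ × ℝ) δ := by
      rw [hc]
      rintro ⟨x, y⟩ ⟨⟨hx1, hx2⟩, ⟨hy1, hy2⟩⟩
      simp only at hx1 hx2 hy1 hy2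
      rw [Metric.mem_ball, dist_zero_right, Prod.norm_def]
      refine max_lt ?_ ?_ <;> simp only [Real.norm_eq_abs] <;> rw [abs_lt] <;> constructor <;> linarith
    rw [← hc]
    refine bar_half ((convex_Ioo _ _).prod (convex_Ioo _ _)) (isOpen_Ioo.prod isOpen_Ioo) ?_
      (subset_closure.trans hcl) hcl hf hf' hb
    intro h
    exact h0 h.1
  have k1 := key 0 (δ/2) (by simp) (by linarith) le_rfl (by linarith) (by simp)
  have k2 := key (-(δ/2)) 0 (by simp; intro h; linarith) le_rfl (by linarith) (by linarith) (by simp)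
  refine (k1.union k2).hasFDerivAt ?_
  have : Metric.ball (0 : ℝ × ℝ) (δ/2) ∈ 𝓝 (0 : ℝ × ℝ) := Metric.ball_mem_nhds _ (by linarith)
  filter_upwards [this] with p hp
  rw [Metric.mem_ball, dist_zero_right, Prod.norm_def, max_lt_iff] at hp
  simp only [Real.norm_eq_abs, abs_lt] at hp
  obtain ⟨⟨x1, x2⟩, ⟨y1, y2⟩⟩ := hp
  rcases le_total 0 p.1 with h | h
  · left; exact ⟨⟨h, x2.le⟩, ⟨y1.le, y2.le⟩⟩
  · right; exact ⟨⟨x1.le, h⟩, ⟨y1.le, y2.le⟩⟩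

lemma bar_contDiffAt (n : ℕ) : ∀ {A : ℝ × ℝ → ℝ}, Sm A → FC A → ContDiffAt ℝ n (bar A) 0 := by
  have main : ∀ {A : ℝ × ℝ → ℝ}, Sm A → FC A → ∃ A1 A2, (Sm A1 ∧ FC A1) ∧ (Sm A2 ∧ FC A2) ∧
      ∀ᶠ p in 𝓝 (0 : ℝ × ℝ), HasFDerivAt (bar A) (dbar A1 A2 p) p := by
    intro A hA h
    obtain ⟨A1, A2, h1, h2, hd⟩ := h.derivs hA
    refine ⟨A1, A2, h1, h2, ?_⟩
    have hp := bar_hasFDerivAt_ne hA h h1.2 h2.2 hd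
    have c1 := bar_cont0 h1.1.continuousAt
    have c2 := bar_cont0 h2.1.continuousAt
    have hc : ContinuousAt (dbar A1 A2) 0 :=
      (c2.smul continuousAt_const).add (c1.smul continuousAt_const)
    have h0 := hasFDerivAt_zero_of_punctured (bar_cont0 hA.continuousAt) hc hp
    filter_upwards [hp] with p hp
    by_cases h : p = 0
    · rw [h]; exact h0
    · exact hp h
  induction n with
  | zero =>
    intro A hA h
    obtain ⟨A1, A2, h1, h2, hd⟩ := main hA h
    rw [Nat.cast_zero, contDiffAt_zero]
    refine ⟨_, hd, fun p hp => ?_⟩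
    exact (HasFDerivAt.continuousAt hp).continuousWithinAt
  | succ n ih =>
    intro A hA h
    obtain ⟨A1, A2, h1, h2, hd⟩ := main hA h
    rw [show ((n + 1 : ℕ) : WithTop ℕ∞) = (n : WithTop ℕ∞) + 1 by simp,
      contDiffAt_succ_iff_hasFDerivAt]
    exact ⟨dbar A1 A2, ⟨_, hd, fun p hp => hp⟩,
      ((ih h2.1 h2.2).smul contDiffAt_const).add ((ih h1.1 h1.2).smul contDiffAt_const)⟩

lemma bar_Sm {A : ℝ × ℝ → ℝ} (hA : Sm A) (h : FC A) : Sm (bar A) :=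
  Sm_iff.2 fun n => bar_contDiffAt n hA h

end descent2

set_option linter.unusedSectionVars false

section prep

lemma ev_tau2 {P : (ℝ × ℝ) × ℝ → Prop} (h : ∀ᶠ p in 𝓝 (0 : (ℝ × ℝ) × ℝ), P p) :
    ∀ᶠ u in 𝓝 (0 : ℝ), ∀ α β, P ((u, tau u α), tau u β) := by
  obtain ⟨ε, hε, hP⟩ := Metric.eventually_nhds_iff.1 h
  filter_upwards [Metric.ball_mem_nhds (0:ℝ) hε] with u hu α β
  apply hP
  have hu' : |u| < ε := by simpa using hu
  rw [dist_zero_right, Prod.norm_def, Prod.norm_def]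
  exact max_lt (max_lt hu' ((tau_abs u α).trans_lt hu')) ((tau_abs u β).trans_lt hu')

lemma quad_unique {a b c a' b' c' x y z : ℝ} (hxy : x ≠ y) (hxz : x ≠ z) (hyz : y ≠ z)
    (h1 : a + b * x + c * x ^ 2 = a' + b' * x + c' * x ^ 2)
    (h2 : a + b * y + c * y ^ 2 = a' + b' * y + c' * y ^ 2)
    (h3 : a + b * z + c * z ^ 2 = a' + b' * z + c' * z ^ 2) : a = a' ∧ b = b' ∧ c = c' := by
  have e1 : (b - b') + (c - c') * (x + y) = 0 := by
    refine mul_left_cancel₀ (sub_ne_zero.2 hxy) ?_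
    linear_combination h1 - h2
  have e2 : (b - b') + (c - c') * (x + z) = 0 := by
    refine mul_left_cancel₀ (sub_ne_zero.2 hxz) ?_
    linear_combination h1 - h3
  have e3 : c - c' = 0 := by
    refine mul_left_cancel₀ (sub_ne_zero.2 hyz) ?_
    linear_combination e1 - e2
  have hc : c = c' := by linarith
  have hb : b = b' := by rw [e3] at e1; linarith
  exact ⟨by rw [hc, hb] at h1; linarith, hb, hc⟩

lemma tau_distinct {u α : ℝ} (hu : u ≠ 0) (hs : Real.sin (3 * α) ≠ 0) :
    tau u α ≠ tau u (α + 2 * Real.pi / 3) ∧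
    tau u α ≠ tau u (α + 2 * Real.pi / 3 + 2 * Real.pi / 3) ∧
    tau u (α + 2 * Real.pi / 3) ≠ tau u (α + 2 * Real.pi / 3 + 2 * Real.pi / 3) := by
  have s3 : √3 ^ 2 = (3:ℝ) := Real.sq_sqrt (by norm_num)
  have hs3 : Real.sin (3 * α) = Real.sin α * (4 * Real.cos α ^ 2 - 1) := by
    rw [Real.sin_three_mul]
    linear_combination (-4 * Real.sin α) * Real.sin_sq_add_cos_sq α
  have hsc := Real.sin_sq_add_cos_sq α
  have c2 : Real.cos (α + 2 * Real.pi / 3 + 2 * Real.pi / 3) =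
      -(1/2) * Real.cos α + √3 / 2 * Real.sin α := by
    rw [cos_third, cos_third, sin_third]
    linear_combination (-(1/4) * Real.cos α) * s3
  have red : ∀ a b, tau u a = tau u b → Real.cos a = Real.cos b := by
    intro a b h
    unfold tau at h
    have := mul_left_cancel₀ (by positivity : u / 3 ≠ 0) h
    linarith
  refine ⟨fun h => hs ?_, fun h => hs ?_, fun h => hs ?_⟩
  · have := red _ _ h
    rw [cos_third] at this
    have e : 4 * Real.cos α ^ 2 - 1 = 0 := by
      linear_combination (Real.cos α * 2 - √3 * Real.sin α * (2/3)) * this + hsc +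
        (1/3) * Real.sin α ^ 2 * s3
    rw [hs3, e, mul_zero]
  · have := red _ _ h
    rw [c2] at this
    have e : 4 * Real.cos α ^ 2 - 1 = 0 := by
      linear_combination (Real.cos α * 2 + √3 * Real.sin α * (2/3)) * this + hsc +
        (1/3) * Real.sin α ^ 2 * s3
    rw [hs3, e, mul_zero]
  · have := red _ _ h
    rw [c2, cos_third] at this
    have e : Real.sin α = 0 := by
      have : √3 * Real.sin α = 0 := by linarith
      exact (mul_eq_zero.1 this).resolve_left (by positivity)
    rw [hs3, e, zero_mul]

lemma Tg_tau_third (u α : ℝ) : Tg (u, tau u (α + 2 * Real.pi / 3)) = Tg (u, tau u α) := by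
  rw [Tg_tau, Tg_tau, cos3_third]

lemma prep_quad {f : ℝ × ℝ → ℝ} (hf : Sm f) : ∃ A B C : ℝ × ℝ → ℝ, Sm A ∧ Sm B ∧ Sm C ∧
    ∀ᶠ q in 𝓝 (0 : (ℝ × ℝ) × ℝ), Tg (q.1.1, q.2) = Tg q.1 →
      f (q.1.1, q.2) = A q.1 + B q.1 * q.2 + C q.1 * q.2 ^ 2 := by
  have hF : Sm (fun q : (ℝ × ℝ) × ℝ => f (q.1.1, q.1.2 + q.2)) :=
    hf.comp (f := fun q : (ℝ × ℝ) × ℝ => (q.1.1, q.1.2 + q.2))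
      (ContDiff.contDiffAt (by fun_prop)) (by simp)
  obtain ⟨g, hg, h1⟩ := hadamard hF
  have hφ : Sm (fun q : (ℝ × ℝ) × ℝ => g (q.1, q.2 - (3 * q.1.2 + q.1.1) / 2)) :=
    hg.comp (f := fun q : (ℝ × ℝ) × ℝ => (q.1, q.2 - (3 * q.1.2 + q.1.1) / 2))
      (ContDiff.contDiffAt (by fun_prop)) (by simp)
  obtain ⟨E, O, hE, hO, h2⟩ := whitney hφ
  have hw : ContDiff ℝ (⊤ : ℕ∞) (fun p : ℝ × ℝ => (p, (p.2 + p.1) * (p.1 - 3 * p.2) / 4)) := by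
    fun_prop
  have he : ContDiffAt ℝ (⊤ : ℕ∞) (fun p : ℝ × ℝ => E (p, (p.2 + p.1) * (p.1 - 3 * p.2) / 4)) 0 :=
    hE.comp (f := fun p : ℝ × ℝ => (p, (p.2 + p.1) * (p.1 - 3 * p.2) / 4)) hw.contDiffAt (by simp)
  have ho : ContDiffAt ℝ (⊤ : ℕ∞) (fun p : ℝ × ℝ => O (p, (p.2 + p.1) * (p.1 - 3 * p.2) / 4)) 0 :=
    hO.comp (f := fun p : ℝ × ℝ => (p, (p.2 + p.1) * (p.1 - 3 * p.2) / 4)) hw.contDiffAt (by simp)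
  set e := fun p : ℝ × ℝ => E (p, (p.2 + p.1) * (p.1 - 3 * p.2) / 4) with hed
  set o := fun p : ℝ × ℝ => O (p, (p.2 + p.1) * (p.1 - 3 * p.2) / 4) with hod
  have hf' : ContDiffAt ℝ (⊤ : ℕ∞) f 0 := hf
  refine ⟨fun p => f p - p.2 * (e p + (p.2 + p.1) * o p / 2),
    fun p => e p + (p.2 + p.1) * o p / 2 - p.2 * o p, o, ?_, ?_, ho, ?_⟩
  · unfold Sm; fun_prop
  · unfold Sm; fun_prop
  have t1 : Tendsto (fun q : (ℝ × ℝ) × ℝ => (q.1, q.2 - q.1.2)) (𝓝 0) (𝓝 0) := by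
    have h : Continuous (fun q : (ℝ × ℝ) × ℝ => (q.1, q.2 - q.1.2)) := by fun_prop
    simpa [← Prod.zero_eq_mk] using h.tendsto 0
  have t2 : Tendsto (fun q : (ℝ × ℝ) × ℝ => (q.1, q.2 + (q.1.2 + q.1.1) / 2)) (𝓝 0) (𝓝 0) := by
    have h : Continuous (fun q : (ℝ × ℝ) × ℝ => (q.1, q.2 + (q.1.2 + q.1.1) / 2)) := by fun_prop
    simpa [← Prod.zero_eq_mk] using h.tendsto 0
  filter_upwards [t1.eventually h1, t2.eventually h2] with q a b hT
  obtain ⟨⟨u, t⟩, s⟩ := q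
  simp only at a b hT ⊢
  by_cases hst : s = t
  · rw [hst]; ring
  have hfib : s ^ 2 + s * t + t ^ 2 + u * (s + t) = 0 := by
    refine mul_left_cancel₀ (sub_ne_zero.2 hst) ?_
    unfold Tg at hT; simp only at hT
    linear_combination hT
  have hsq : (s + (t + u) / 2) ^ 2 = (t + u) * (u - 3 * t) / 4 := by
    linear_combination hfib
  rw [hsq, show s + (t + u) / 2 - (3 * t + u) / 2 = s - t by ring] at b
  rw [b, show t + (s - t) = s by ring, add_zero] at a
  rw [a]
  simp only [hed, hod]
  ring

lemma prep {f : ℝ × ℝ → ℝ} (hf : Sm f) : ∃ A B C : ℝ × ℝ → ℝ, Sm A ∧ Sm B ∧ Sm C ∧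
    ∀ᶠ p in 𝓝 (0 : ℝ × ℝ),
      f p = A (p.1, Tg p) + B (p.1, Tg p) * p.2 + C (p.1, Tg p) * p.2 ^ 2 := by
  obtain ⟨A, B, C, hA, hB, hC, h⟩ := prep_quad hf
  have key : ∀ᶠ u in 𝓝 (0 : ℝ), u ≠ 0 → ∀ α, Real.sin (3 * α) ≠ 0 →
      A (u, tau u α) = A (u, tau u (α + 2 * Real.pi / 3)) ∧
      B (u, tau u α) = B (u, tau u (α + 2 * Real.pi / 3)) ∧
      C (u, tau u α) = C (u, tau u (α + 2 * Real.pi / 3)) := by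
    filter_upwards [ev_tau2 h] with u hu hu0 α hs
    obtain ⟨d1, d2, d3⟩ := tau_distinct hu0 hs
    have T1 := Tg_tau_third u α
    have T2 := Tg_tau_third u (α + 2 * Real.pi / 3)
    have a0 := hu α α rfl
    have a1 := hu α (α + 2 * Real.pi / 3) T1
    have a2 := hu α (α + 2 * Real.pi / 3 + 2 * Real.pi / 3) (T2.trans T1)
    have b0 := hu (α + 2 * Real.pi / 3) α T1.symm
    have b1 := hu (α + 2 * Real.pi / 3) (α + 2 * Real.pi / 3) rfl
    have b2 := hu (α + 2 * Real.pi / 3) (α + 2 * Real.pi / 3 + 2 * Real.pi / 3) T2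
    exact quad_unique d1 d2 d3 (a0.symm.trans b0) (a1.symm.trans b1) (a2.symm.trans b2)
  have FA : FC A := FC_of_sin hA (key.mono fun u k hu α hs => (k hu α hs).1)
  have FB : FC B := FC_of_sin hB (key.mono fun u k hu α hs => (k hu α hs).2.1)
  have FCC : FC C := FC_of_sin hC (key.mono fun u k hu α hs => (k hu α hs).2.2)
  refine ⟨bar A, bar B, bar C, bar_Sm hA FA, bar_Sm hB FB, bar_Sm hC FCC, ?_⟩
  have td : Tendsto (fun p : ℝ × ℝ => (p, p.2)) (𝓝 0) (𝓝 0) := by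
    have h : Continuous (fun p : ℝ × ℝ => (p, p.2)) := by fun_prop
    simpa [← Prod.zero_eq_mk] using h.tendsto 0
  filter_upwards [td.eventually h, bar_eq2 FA, bar_eq2 FB, bar_eq2 FCC] with p a b c d
  rw [← b, ← c, ← d]
  exact a rfl

end prep

/-- Generation of the module `ℛ_g^{(3)}` for `g(u,t) = (u, t³ + ut²)`: any `C^∞` germ `h`
at `0 ∈ ℝ²` with `h = t³·k₁` and `∂h/∂t = t³·(3t² + 2ut)·k₂` near `0` can be written as
`h = a(u,T)·T₃ + b(u,T)·T·T₁ + c(u,T)·T₁²` near `0`. -/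
theorem ramification_R3_generators
    (h : ℝ × ℝ → ℝ) (hh : ContDiffAt ℝ (⊤ : ℕ∞) h 0)
    (k₁ k₂ : ℝ × ℝ → ℝ)
    (hk₁ : ContDiffAt ℝ (⊤ : ℕ∞) k₁ 0) (hk₂ : ContDiffAt ℝ (⊤ : ℕ∞) k₂ 0)
    (hdiv : ∀ᶠ p in 𝓝 (0 : ℝ × ℝ), h p = p.2 ^ 3 * k₁ p)
    (hdert : ∀ᶠ p in 𝓝 (0 : ℝ × ℝ),
      fderiv ℝ h p (0, 1) = p.2 ^ 3 * (3 * p.2 ^ 2 + 2 * p.1 * p.2) * k₂ p) :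
    ∃ a b c : ℝ × ℝ → ℝ,
      ContDiffAt ℝ (⊤ : ℕ∞) a 0 ∧ ContDiffAt ℝ (⊤ : ℕ∞) b 0 ∧ ContDiffAt ℝ (⊤ : ℕ∞) c 0 ∧
      ∀ᶠ p in 𝓝 (0 : ℝ × ℝ),
        h p = a (p.1, Tg p) * T3 p + b (p.1, Tg p) * (Tg p * T1 p) +
          c (p.1, Tg p) * (T1 p) ^ 2 := by
  have hS : Sm h := hh
  let q : ℝ × ℝ → ℝ := fun p => (3 * p.2 + 2 * p.1) * k₂ p
  have hq' : Sm q := by unfold Sm; fun_prop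
  have hd : ∀ᶠ p in 𝓝 (0 : ℝ × ℝ), HasDerivAt (fun t => h (p.1, t)) (p.2 ^ 4 * q p) p.2 := by
    filter_upwards [hdert, hS.ev_diff] with p h1 h2
    refine (hasDerivAt_dt h2).congr_deriv ?_
    unfold dt
    rw [h1]; simp only [q]; ring
  have hK := hadamard_n hq' 4 hd
  obtain ⟨A, B, C, hA, hB, hC, hp⟩ := prep (Sm_hq hq' 4)
  have tz : Tendsto (fun p : ℝ × ℝ => (p.1, (0:ℝ))) (𝓝 0) (𝓝 0) := by
    have h : Continuous (fun p : ℝ × ℝ => (p.1, (0:ℝ))) := by fun_prop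
    simpa [← Prod.zero_eq_mk] using h.tendsto 0
  have h5 : ∀ᶠ p in 𝓝 (0 : ℝ × ℝ), h p = p.2 ^ 5 *
      (A (p.1, Tg p) + B (p.1, Tg p) * p.2 + C (p.1, Tg p) * p.2 ^ 2) := by
    filter_upwards [hK, hp, tz.eventually hdiv] with p a b c
    rw [a, b, c]; simp
  have tc : Tendsto (fun u : ℝ => (u, -(2/3) * u)) (𝓝 0) (𝓝 0) := by
    have h : Continuous (fun u : ℝ => (u, -(2/3) * u)) := by fun_prop
    simpa [← Prod.zero_eq_mk] using h.tendsto 0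
  have ty : Tendsto (fun u : ℝ => (u, 4 / 27 * u ^ 3)) (𝓝 0) (𝓝 0) := by
    have h : Continuous (fun u : ℝ => (u, 4 / 27 * u ^ 3)) := by fun_prop
    simpa [← Prod.zero_eq_mk] using h.tendsto 0
  have hA' : ContDiffAt ℝ (⊤ : ℕ∞) A 0 := hA
  have hB' : ContDiffAt ℝ (⊤ : ℕ∞) B 0 := hB
  have hC' : ContDiffAt ℝ (⊤ : ℕ∞) C 0 := hC
  have hW : Sm (fun p : ℝ × ℝ => 5 * A p - 4 * p.1 * B p + 28 / 9 * p.1 ^ 2 * C p) := by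
    unfold Sm; fun_prop
  have hcS : Sm (fun u : ℝ => 4 / 27 * u ^ 3) := by
    unfold Sm; fun_prop
  have hcrit : ∀ᶠ u in 𝓝 (0 : ℝ), u ≠ 0 →
      5 * A (u, 4 / 27 * u ^ 3) - 4 * u * B (u, 4 / 27 * u ^ 3) +
        28 / 9 * u ^ 2 * C (u, 4 / 27 * u ^ 3) = 0 := by
    filter_upwards [tc.eventually h5.eventually_nhds, tc.eventually hd, ty.eventually hA.ev_diff,
      ty.eventually hB.ev_diff, ty.eventually hC.ev_diff] with u e1 e2 dA dB dC hu
    set c : ℝ := -(2/3) * u with hc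
    have hTc : Tg (u, c) = 4 / 27 * u ^ 3 := by unfold Tg; simp only [hc]; ring
    have hTd : HasDerivAt (fun t => Tg (u, t)) 0 c := by
      have := ((hasDerivAt_id c).pow 3).add (((hasDerivAt_id c).pow 2).const_mul u)
      refine this.congr_deriv ?_
      simp [hc]; ring
    have comp : ∀ F : ℝ × ℝ → ℝ, DifferentiableAt ℝ F (u, 4 / 27 * u ^ 3) →
        HasDerivAt (fun t => F (u, Tg (u, t))) 0 c := by
      intro F hF
      rw [← hTc] at hF
      have := hF.hasFDerivAt.comp_hasDerivAt c ((hasDerivAt_const c u).prodMk hTd)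
      refine this.congr_deriv ?_
      exact map_zero _
    have D := ((hasDerivAt_id c).pow 5).mul (((comp A dA).add ((comp B dB).mul (hasDerivAt_id c))).add
      ((comp C dC).mul ((hasDerivAt_id c).pow 2)))
    have tl : Tendsto (fun t : ℝ => (u, t)) (𝓝 c) (𝓝 (u, c)) := by
      have h : Continuous (fun t : ℝ => (u, t)) := by fun_prop
      exact h.tendsto c
    have D2 := e2.congr_of_eventuallyEq (f₁ := fun t => t ^ 5 *
      (A (u, Tg (u, t)) + B (u, Tg (u, t)) * t + C (u, Tg (u, t)) * t ^ 2))
      ((tl.eventually e1).mono fun t ht => ht.symm)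
    have E := D2.unique D
    simp only [q, Pi.add_apply, Pi.mul_apply, Pi.pow_apply, id, hTc] at E
    have hq0 : 3 * c + 2 * u = 0 := by rw [hc]; ring
    rw [hq0] at E
    have hc0 : c ^ 4 ≠ 0 := by
      have : c ≠ 0 := by rw [hc]; intro h; apply hu; linarith
      positivity
    refine mul_left_cancel₀ hc0 ?_
    rw [hc] at E ⊢
    push_cast at E
    norm_num at E
    linear_combination -E
  obtain ⟨Q, hQ, hWQ⟩ := HD hW hcS (by simp) hcrit
  have hQ' : ContDiffAt ℝ (⊤ : ℕ∞) Q 0 := hQ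
  let c : ℝ × ℝ → ℝ := fun p => 16 / 45 * Q p
  let b : ℝ × ℝ → ℝ := fun p => 4 / 3 * (C p - 7 * p.1 / 16 * c p)
  let a : ℝ × ℝ → ℝ := fun p => 2 * (B p - 17 * p.1 / 12 * b p - 4 * p.1 ^ 2 / 9 * c p)
  have hc : ContDiffAt ℝ (⊤ : ℕ∞) c 0 := by fun_prop
  have hb : ContDiffAt ℝ (⊤ : ℕ∞) b 0 := by fun_prop
  have ha : ContDiffAt ℝ (⊤ : ℕ∞) a 0 := by fun_prop
  refine ⟨a, b, c, ha, hb, hc, ?_⟩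
  have tT : Tendsto (fun p : ℝ × ℝ => (p.1, Tg p)) (𝓝 0) (𝓝 0) := by
    have h : Continuous (fun p : ℝ × ℝ => (p.1, Tg p)) := by unfold Tg; fun_prop
    simpa [← Prod.zero_eq_mk, Tg] using h.tendsto 0
  filter_upwards [h5, tT.eventually hWQ] with p e1 e2
  simp only [a, b, c]
  rw [e1]
  generalize A (p.1, Tg p) = α at *
  generalize B (p.1, Tg p) = β at *
  generalize C (p.1, Tg p) = γ at *
  generalize Q (p.1, Tg p) = κ at *
  unfold Tg at *
  unfold T1 T3
  linear_combination (p.2 ^ 5 / 5) * e2
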